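/- Let m ≥ 3 and let n(m) denote the number of CCZ-equivalence classes among all APN Taniguchi functions f_{k,α,β} on F_{2^m} × F_{2^m} (that is, all f_{k,α,β} with 0 < k < m, gcd(k,m) = 1, α, β ∈ F_{2^m}, β ≠ 0, and X^{2^k+1} + αX + β without roots in F_{2^m}). Then n(m) = φ(m)·b(m)/2 if m is odd, and n(m) = φ(m)·(b(m)+1)/2 if m is even, where φ is Euler's totient function and b(m) is the number of orbits under β ↦ β^2 of the set {β ∈ F_{2^m} : X^{2^k+1} + X + β has no root in F_{2^m}} for any fixed k coprime to m. -/

import Mathlib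

/-- The Taniguchi function `f_{k,α,β}` on `K × K`. -/
def taniguchi {K : Type*} [Field K] (k : ℕ) (α β : K) : K × K → K × K :=
  fun p => (p.1 ^ (2 ^ (2 * k) * (2 ^ k + 1)) + α * p.1 ^ (2 ^ (2 * k)) * p.2 ^ (2 ^ k)
      + β * p.2 ^ (2 ^ k + 1), p.1 * p.2)

/-- Two functions `f, g` on a finite-dimensional `F_2`-vector space `V` are CCZ-equivalent
if some affine permutation of `V × V` (an `F_2`-linear bijection composed with a
translation) maps the graph of `f` onto the graph of `g`. -/
def CCZEquivalent {V : Type*} [AddCommGroup V] [Module (ZMod 2) V] (f g : V → V) : Prop :=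
  ∃ (A : V × V → V × V) (c : V × V), IsLinearMap (ZMod 2) A ∧ Function.Bijective A ∧
    (fun p => A p + c) '' {p : V × V | p.2 = f p.1} = {p : V × V | p.2 = g p.1}

/-- The set of all APN Taniguchi functions on `F_{2^m} × F_{2^m}`. -/
def TanSet (m : ℕ) :
    Set ((GaloisField 2 m × GaloisField 2 m) → (GaloisField 2 m × GaloisField 2 m)) :=
  {f | ∃ (k : ℕ) (α β : GaloisField 2 m), 0 < k ∧ k < m ∧ Nat.gcd k m = 1 ∧ β ≠ 0 ∧
    (∀ x : GaloisField 2 m, x ^ (2 ^ k + 1) + α * x + β ≠ 0) ∧ f = taniguchi k α β}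

/-- `n(m)`: the number of CCZ-equivalence classes among all APN Taniguchi functions on
`F_{2^m} × F_{2^m}`. -/
noncomputable def numTaniguchiClasses (m : ℕ) : ℕ :=
  {C : Set ((GaloisField 2 m × GaloisField 2 m) → (GaloisField 2 m × GaloisField 2 m)) |
    ∃ f ∈ TanSet m, C = {g | g ∈ TanSet m ∧ CCZEquivalent f g}}.ncard

/-- `b(m)` relative to a fixed `k` coprime to `m`: the number of orbits under `β ↦ β^2`
of the set of `β` such that `X^(2^k+1) + X + β` has no root in `F_{2^m}`. -/
noncomputable def orbitCount (k m : ℕ) : ℕ :=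
  {S : Set (GaloisField 2 m) |
    ∃ β : GaloisField 2 m, (∀ x : GaloisField 2 m, x ^ (2 ^ k + 1) + x + β ≠ 0) ∧
      S = {γ | ∃ i : ℕ, i < m ∧ γ = β ^ 2 ^ i}}.ncard



/-- In a finite `p`-group `S`, a subgroup that equals each of its conjugates with which it
normalizes mutually is normal. -/
lemma normal_of_mutual {S : Type*} [Group S] [Finite S] {p : ℕ} [Fact p.Prime] (hS : IsPGroup p S)
    (T : Subgroup S)
    (h : ∀ s : S, (∀ t ∈ T, ∀ u ∈ T, t * (s * u * s⁻¹) * t⁻¹ ∈ T.map (MulAut.conj s).toMonoidHom) →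
      (∀ t ∈ T, ∀ u ∈ T, (s * u * s⁻¹) * t * (s * u * s⁻¹)⁻¹ ∈ T) →
      T = T.map (MulAut.conj s).toMonoidHom) : T.Normal := by
  have hn := hS.isNilpotent
  have hc := Group.normalizerCondition_of_isNilpotent (G := S)
  rw [← Subgroup.normalizer_eq_top_iff]
  by_contra hne
  have hlt := hc _ (lt_top_iff_ne_top.mpr hne)
  obtain ⟨s, hs, hsn⟩ := SetLike.exists_of_lt hlt
  apply hsn
  have hs1 := Subgroup.mem_normalizer_iff.mp hs
  have hTN : ∀ t ∈ T, t ∈ Subgroup.normalizer (T : Set S) := fun t ht => Subgroup.le_normalizer ht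
  have key := h s ?_ ?_
  · rw [Subgroup.mem_normalizer_iff]
    intro x
    constructor
    · intro hx
      rw [key]
      exact ⟨x, hx, by simp⟩
    · intro hx
      rw [key] at hx
      obtain ⟨y, hy, hyx⟩ := hx
      simp at hyx
      rwa [← hyx]
  · intro t ht u hu
    -- s⁻¹ t s normalizes T
    have h1 : s⁻¹ * t * s ∈ Subgroup.normalizer (T : Set S) := by
      rw [hs1]
      have : s * (s⁻¹ * t * s) * s⁻¹ = t := by group
      rw [this]; exact hTN t ht
    have h2 := (Subgroup.mem_normalizer_iff.mp h1 u).mp hu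
    refine ⟨_, h2, ?_⟩
    simp
    group
  · intro t ht u hu
    have h1 := (hs1 u).mp (hTN u hu)
    exact (Subgroup.mem_normalizer_iff.mp h1 t).mp ht

/-- Sylow-type argument. -/
lemma conj_of_mutual {G : Type*} [Group G] [Finite G] {p : ℕ} [Fact p.Prime]
    (F : Set (Subgroup G)) (hp : ∀ T ∈ F, IsPGroup p T)
    (hconj : ∀ T ∈ F, ∀ s : G, T.map (MulAut.conj s).toMonoidHom ∈ F)
    (hmut : ∀ T ∈ F, ∀ T' ∈ F, (∀ t ∈ T, ∀ u ∈ T', t * u * t⁻¹ ∈ T') →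
      (∀ t ∈ T, ∀ u ∈ T', u * t * u⁻¹ ∈ T) → T = T')
    (T : Subgroup G) (hT : T ∈ F) (T' : Subgroup G) (hT' : T' ∈ F) :
    ∃ s : G, T = T'.map (MulAut.conj s).toMonoidHom := by
  obtain ⟨S, hS⟩ := (hp T hT).exists_le_sylow
  obtain ⟨S', hS'⟩ := (hp T' hT').exists_le_sylow
  obtain ⟨s, hs⟩ := MulAction.exists_smul_eq G S' S
  refine ⟨s, ?_⟩
  have hle : T'.map (MulAut.conj s).toMonoidHom ≤ (S : Subgroup G) := by
    rw [← hs]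
    rintro _ ⟨x, hx, rfl⟩
    exact ⟨x, hS' hx, rfl⟩
  have hF := hconj T' hT' s
  set T2 := T'.map (MulAut.conj s).toMonoidHom
  -- members of F inside S are normal in S
  have hnorm : ∀ A ∈ F, A ≤ (S : Subgroup G) → ∀ x ∈ (S : Subgroup G), ∀ a ∈ A, x * a * x⁻¹ ∈ A := by
    intro A hA hAS x hx a ha
    have := normal_of_mutual S.isPGroup' (A.subgroupOf S) ?_
    · exact this.conj_mem ⟨a, hAS ha⟩ ha ⟨x, hx⟩
    · rintro ⟨y, hy⟩ h1 h2
      have hAy := hmut A hA _ (hconj A hA y) ?_ ?_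
      · ext ⟨z, hz⟩
        rw [Subgroup.mem_subgroupOf]
        constructor
        · intro hzA
          simp only at hzA
          rw [hAy] at hzA
          obtain ⟨w, hw, hwz⟩ := hzA
          refine ⟨⟨w, hAS hw⟩, hw, ?_⟩
          ext
          simpa using hwz
        · rintro ⟨w, hw, hwz⟩
          simp only
          rw [hAy]
          refine ⟨w, hw, ?_⟩
          have := congrArg Subtype.val hwz
          simpa using this
      · rintro t ht _ ⟨u, hu, rfl⟩
        obtain ⟨w, hw, hwz⟩ := h1 ⟨t, hAS ht⟩ ht ⟨u, hAS hu⟩ hu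
        refine ⟨w, hw, ?_⟩
        have := congrArg Subtype.val hwz
        simpa using this
      · rintro t ht _ ⟨u, hu, rfl⟩
        have := h2 ⟨t, hAS ht⟩ ht ⟨u, hAS hu⟩ hu
        rw [Subgroup.mem_subgroupOf] at this
        simpa using this
  exact hmut T hT T2 hF (fun t ht u hu => hnorm T2 hF hle t (hS ht) u hu)
    (fun t ht u hu => hnorm T hT hS u (hle hu) t ht)


section Yoshiara

variable {V : Type*} [AddCommGroup V]

/-- polarization of `f` -/
def QB (f : V → V) (x y : V) : V := f (x + y) + f x + f y

/-- quadratic APN functions (with non-degeneracy) -/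
structure QuadAPN (f : V → V) : Prop where
  zero : f 0 = 0
  add : ∀ x y z, QB f (x + y) z = QB f x z + QB f y z
  apn : ∀ a x, a ≠ 0 → QB f a x = 0 → x = 0 ∨ x = a
  span : ∀ H : AddSubgroup V, (∀ x y, QB f x y ∈ H) → H = ⊤

lemma QB_comm (f : V → V) (x y : V) : QB f x y = QB f y x := by
  unfold QB
  rw [add_comm x y]
  abel

lemma ch2_neg {W : Type*} [AddCommGroup W] (h2 : ∀ x : W, x + x = 0) (x : W) : -x = x :=
  neg_eq_of_add_eq_zero_left (h2 x)

lemma ch2_eq {W : Type*} [AddCommGroup W] (h2 : ∀ x : W, x + x = 0) {x y : W} (h : x + y = 0) :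
    x = y := by
  rw [← ch2_neg h2 y]; exact eq_neg_of_add_eq_zero_left h

lemma QuadAPN.zero_left {f : V → V} (h2 : ∀ x : V, x + x = 0) (hf : QuadAPN f) (x : V) :
    QB f 0 x = 0 := by
  unfold QB; rw [hf.zero, zero_add, add_zero, h2]

lemma QuadAPN.zero_right {f : V → V} (h2 : ∀ x : V, x + x = 0) (hf : QuadAPN f) (x : V) :
    QB f x 0 = 0 := by
  rw [QB_comm, hf.zero_left h2]

lemma QuadAPN.add_right {f : V → V} (hf : QuadAPN f) (x y z : V) :
    QB f x (y + z) = QB f x y + QB f x z := by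
  rw [QB_comm, hf.add, QB_comm f y, QB_comm f z]

lemma QuadAPN.self {f : V → V} (h2 : ∀ x : V, x + x = 0) (hf : QuadAPN f) (x : V) :
    QB f x x = 0 := by
  unfold QB; rw [h2, hf.zero, zero_add, h2]

lemma QB_expand (h2 : ∀ x : V, x + x = 0) (f : V → V) (x y : V) :
    f (x + y) = f x + f y + QB f x y := by
  unfold QB
  have h1 := h2 (f x)
  have h3 := h2 (f y)
  grind

/-- translation automorphism -/
def trF (h2 : ∀ x : V, x + x = 0) (f : V → V) (hf : QuadAPN f) (a : V) : Equiv.Perm (V × V) where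
  toFun p := (p.1 + a, p.2 + QB f a p.1 + f a)
  invFun p := (p.1 + a, p.2 + QB f a p.1 + f a)
  left_inv p := by
    have h1 := h2 a
    have h3 := h2 (f a)
    have h4 := h2 (QB f a p.1)
    have h5 := hf.self h2 a
    have h6 := hf.add_right a p.1 a
    ext <;> simp <;> grind
  right_inv p := by
    have h1 := h2 a
    have h3 := h2 (f a)
    have h4 := h2 (QB f a p.1)
    have h5 := hf.self h2 a
    have h6 := hf.add_right a p.1 a
    ext <;> simp <;> grind

lemma trF_apply (h2 : ∀ x : V, x + x = 0) (f : V → V) (hf : QuadAPN f) (a : V) (p : V × V) :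
    trF h2 f hf a p = (p.1 + a, p.2 + QB f a p.1 + f a) := rfl

lemma trF_mul (h2 : ∀ x : V, x + x = 0) (f : V → V) (hf : QuadAPN f) (a b : V) :
    trF h2 f hf a * trF h2 f hf b = trF h2 f hf (a + b) := by
  ext p
  · simp [trF_apply]; abel
  · simp only [Equiv.Perm.mul_apply, trF_apply]
    have h1 := hf.add_right a p.1 b
    have h3 := hf.add a b p.1
    have h4 := QB_expand h2 f a b
    grind

lemma trF_zero (h2 : ∀ x : V, x + x = 0) (f : V → V) (hf : QuadAPN f) :
    trF h2 f hf 0 = 1 := by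
  ext p <;> simp [trF_apply, hf.zero, hf.zero_left h2]

lemma trF_inv (h2 : ∀ x : V, x + x = 0) (f : V → V) (hf : QuadAPN f) (a : V) :
    (trF h2 f hf a)⁻¹ = trF h2 f hf a := by
  rw [inv_eq_iff_mul_eq_one, trF_mul, h2, trF_zero]

/-- affine maps in characteristic two -/
def Aff {W : Type*} [AddCommGroup W] (e : Equiv.Perm W) : Prop :=
  ∀ p q r, e (p + q + r) = e p + e q + e r

lemma Aff.mul {W : Type*} [AddCommGroup W] {e e' : Equiv.Perm W} (h : Aff e) (h' : Aff e') :
    Aff (e * e') := by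
  intro p q r
  simp [h' p q r, h _ _ _]

lemma Aff.inv {W : Type*} [AddCommGroup W] {e : Equiv.Perm W} (h : Aff e) : Aff e⁻¹ := by
  intro p q r
  apply e.injective
  rw [h]
  simp

lemma Aff.one {W : Type*} [AddCommGroup W] : Aff (1 : Equiv.Perm W) := fun _ _ _ => rfl

lemma Aff.trF (h2 : ∀ x : V, x + x = 0) (f : V → V) (hf : QuadAPN f) (a : V) :
    Aff (trF h2 f hf a) := by
  intro p q r
  have h1 := hf.add_right a p.1 q.1
  have h3 := hf.add_right a (p.1 + q.1) r.1
  have h4 := h2 a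
  have h5 := h2 (f a)
  ext <;> simp [trF_apply] <;> grind

/-- linear part -/
def LinP {W : Type*} [AddCommGroup W] (e : Equiv.Perm W) (p : W) : W := e p + e 0

lemma LinP_add {W : Type*} [AddCommGroup W] (h2 : ∀ x : W, x + x = 0) {e : Equiv.Perm W}
    (h : Aff e) (p q : W) : LinP e (p + q) = LinP e p + LinP e q := by
  have := h p q 0
  rw [add_zero] at this
  unfold LinP
  have h3 := h2 (e 0)
  grind

lemma LinP_zero {W : Type*} [AddCommGroup W] (h2 : ∀ x : W, x + x = 0) (e : Equiv.Perm W) :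
    LinP e 0 = 0 := h2 _

lemma LinP_mul {W : Type*} [AddCommGroup W] (h2 : ∀ x : W, x + x = 0) {e e' : Equiv.Perm W}
    (h : Aff e) (p : W) : LinP (e * e') p = LinP e (LinP e' p) := by
  unfold LinP
  have := h (e' p) (e' 0) 0
  rw [add_zero] at this
  have h3 := h2 (e 0)
  simp only [Equiv.Perm.mul_apply]
  grind

lemma LinP_inj {W : Type*} [AddCommGroup W] {e : Equiv.Perm W} {p q : W}
    (h : LinP e p = LinP e q) : p = q :=
  e.injective (add_right_cancel h)

lemma LinP_apply {W : Type*} [AddCommGroup W] (h2 : ∀ x : W, x + x = 0) (e : Equiv.Perm W) (p : W) :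
    e p = LinP e p + e 0 := by
  unfold LinP; rw [add_assoc, h2, add_zero]

lemma LinP_trF (h2 : ∀ x : V, x + x = 0) (f : V → V) (hf : QuadAPN f) (a : V) (p : V × V) :
    LinP (trF h2 f hf a) p = (p.1, p.2 + QB f a p.1) := by
  have h1 := h2 a
  have h3 := h2 (f a)
  have h4 := hf.zero_right h2 a
  unfold LinP
  ext <;> simp [trF_apply] <;> grind

/-- mapping the graph of `f` into the graph of `g` -/
def GM (f g : V → V) (E : Equiv.Perm (V × V)) : Prop := ∀ p : V × V, p.2 = f p.1 ↔ (E p).2 = g (E p).1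

lemma GM.mul {f g h : V → V} {E E' : Equiv.Perm (V × V)} (hE : GM g h E) (hE' : GM f g E') :
    GM f h (E * E') := fun p => (hE' p).trans (hE (E' p))

lemma GM.inv {f g : V → V} {E : Equiv.Perm (V × V)} (hE : GM f g E) : GM g f E⁻¹ := by
  intro p
  have := hE (E⁻¹ p)
  simp at this
  exact this.symm

lemma GM.one {f : V → V} : GM f f 1 := fun _ => Iff.rfl

lemma GM.trF (h2 : ∀ x : V, x + x = 0) (f : V → V) (hf : QuadAPN f) (a : V) :
    GM f f (trF h2 f hf a) := by
  intro p
  have := QB_expand h2 f a p.1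
  rw [trF_apply]
  simp only
  rw [add_comm p.1 a, this]
  constructor
  · intro h; rw [h]; abel
  · intro h; grind

lemma prod_ch2 (h2 : ∀ x : V, x + x = 0) (p : V × V) : p + p = 0 := by
  ext <;> simp [h2]

/-- A graph-preserving affine map stabilizing `0 × V` intertwines the polarizations. -/
lemma QB_intertwine (h2 : ∀ x : V, x + x = 0) {f g : V → V} (hf : QuadAPN f) (hg : QuadAPN g)
    {E : Equiv.Perm (V × V)} (hE : Aff E) (hG : GM f g E)
    (h0 : ∀ y, (LinP E (0, y)).1 = 0) (x y : V) :
    (LinP E (0, QB f x y)).2 = QB g (LinP E (x, 0)).1 (LinP E (y, 0)).1 := by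
  have hL := LinP_add (prod_ch2 h2) hE
  have hd : ∀ u v, LinP E (u, v) = LinP E (u, 0) + LinP E (0, v) := by
    intro u v; rw [← hL]; simp
  have key : ∀ u, g ((LinP E (u, 0)).1 + (E 0).1) =
      (LinP E (u, 0)).2 + (LinP E (0, f u)).2 + (E 0).2 := by
    intro u
    have h1 := (hG (u, f u)).mp rfl
    rw [LinP_apply (prod_ch2 h2) E (u, f u), hd] at h1
    simp only [Prod.fst_add, Prod.snd_add, h0, add_zero] at h1
    exact h1.symm
  have k1 := key x
  have k2 := key y
  have k3 := key (x + y)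
  have k4 := key 0
  have e1 : LinP E (x + y, 0) = LinP E (x, 0) + LinP E (y, 0) := by rw [← hL]; simp
  have e2 : LinP E (0, QB f x y) = LinP E (0, f (x + y)) + LinP E (0, f x) + LinP E (0, f y) := by
    rw [← hL, ← hL]; simp [QB]
  have e3 : LinP E ((0 : V), (0 : V)) = 0 := LinP_zero (prod_ch2 h2) E
  rw [hf.zero, e3] at k4
  rw [e1] at k3
  rw [e2]
  simp only [Prod.fst_add, Prod.snd_add, Prod.fst_zero, Prod.snd_zero, zero_add] at *
  have q1 := QB_expand h2 g ((LinP E (x, 0)).1 + (E 0).1) (LinP E (y, 0)).1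
  have q2 := QB_expand h2 g (E 0).1 (LinP E (y, 0)).1
  have q3 := hg.add (LinP E (x, 0)).1 (E 0).1 (LinP E (y, 0)).1
  have q4 : (LinP E (x, 0)).1 + (LinP E (y, 0)).1 + (E 0).1 =
    (LinP E (x, 0)).1 + (E 0).1 + (LinP E (y, 0)).1 := by abel
  rw [q4] at k3
  rw [add_comm (E 0).1] at q2
  have r1 : (LinP E (y, 0)).2 + (LinP E (0, f y)).2 = g (LinP E (y, 0)).1 + QB g (E 0).1 (LinP E (y, 0)).1 := by
    rw [q2, k4] at k2
    have : (E 0).2 + ((LinP E (y, 0)).2 + (LinP E (0, f y)).2) =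
      (E 0).2 + (g (LinP E (y, 0)).1 + QB g (E 0).1 (LinP E (y, 0)).1) := by
      rw [← add_assoc, ← add_assoc, k2]; abel
    exact add_left_cancel this
  rw [q1, k1, q3] at k3
  have r2 : (LinP E (0, f (x + y))).2 = (LinP E (0, f x)).2 + (LinP E (0, f y)).2
      + QB g (LinP E (x, 0)).1 (LinP E (y, 0)).1 := by
    have : ((LinP E (x, 0)).2 + (E 0).2 + (LinP E (y, 0)).2) + (LinP E (0, f (x + y))).2 =
       ((LinP E (x, 0)).2 + (E 0).2 + (LinP E (y, 0)).2) + ((LinP E (0, f x)).2 + (LinP E (0, f y)).2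
      + QB g (LinP E (x, 0)).1 (LinP E (y, 0)).1) := by
      calc _ = (LinP E (x, 0)).2 + (LinP E (y, 0)).2 + (LinP E (0, f (x + y))).2 + (E 0).2 := by abel
        _ = (LinP E (x, 0)).2 + (E 0).2 + (LinP E (0, f x)).2 + QB g (LinP E (x, 0)).1 (LinP E (y, 0)).1
          + (g (LinP E (y, 0)).1 + QB g (E 0).1 (LinP E (y, 0)).1) := by rw [← k3]; abel
        _ = _ := by rw [← r1]; abel
    exact add_left_cancel this
  rw [r2]
  calc _ = ((LinP E (0, f x)).2 + (LinP E (0, f x)).2) + ((LinP E (0, f y)).2 + (LinP E (0, f y)).2) + QB g (LinP E (x, 0)).1 (LinP E (y, 0)).1 := by abel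
    _ = _ := by rw [h2, h2]; simp

lemma idx_two [Finite V] (h : V →+ V) (e : V) (hk : ∀ x, h x = 0 → x = 0 ∨ x = e) (y z : V) :
    y ∈ h.range ∨ z ∈ h.range ∨ y - z ∈ h.range := by
  have h1 := AddSubgroup.card_mul_index h.range
  have h3 : Nat.card h.ker ≤ 2 := by
    have : (h.ker : Set V) ⊆ {0, e} := by
      intro x hx
      simpa using hk x hx
    calc Nat.card h.ker = (h.ker : Set V).ncard := rfl
      _ ≤ ({0, e} : Set V).ncard := Set.ncard_le_ncard this (Set.toFinite _)
      _ ≤ 2 := (Set.ncard_insert_le _ _).trans (by simp)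
  have h4 : Nat.card V = Nat.card h.ker * Nat.card h.range := by
    have := AddSubgroup.card_mul_index h.ker
    rw [AddSubgroup.index_ker] at this
    exact this.symm
  have h5 : 0 < Nat.card h.range := Nat.card_pos
  have h6 : h.range.index ≤ 2 := by nlinarith
  by_contra hcon
  push Not at hcon
  obtain ⟨c1, c2, c3⟩ := hcon
  have hfin : Finite (V ⧸ h.range) := inferInstance
  have : Fintype (V ⧸ h.range) := Fintype.ofFinite _
  have h7 : ({(0 : V ⧸ h.range), (y : V ⧸ h.range), (z : V ⧸ h.range)} : Set _).ncard ≤ 2 := by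
    refine le_trans (Set.ncard_le_card _) h6
  have n1 : (0 : V ⧸ h.range) ≠ (y : V ⧸ h.range) := by
    intro hh
    exact c1 ((QuotientAddGroup.eq_zero_iff y).mp hh.symm)
  have n2 : (0 : V ⧸ h.range) ≠ (z : V ⧸ h.range) := by
    intro hh
    exact c2 ((QuotientAddGroup.eq_zero_iff z).mp hh.symm)
  have n3 : (y : V ⧸ h.range) ≠ (z : V ⧸ h.range) := by
    intro hh
    apply c3
    rw [← QuotientAddGroup.eq_zero_iff, QuotientAddGroup.mk_sub, hh, sub_self]
  rw [Set.ncard_eq_three.mpr ⟨_, _, _, n1, n2, n3, rfl⟩] at h7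
  omega

end Yoshiara


section Yoshiara2

variable {V : Type*} [AddCommGroup V]

lemma core_h0 [Finite V] (h2 : ∀ x : V, x + x = 0) (hc : 16 ≤ Nat.card V) {f : V → V} (hf : QuadAPN f)
    {u : Equiv.Perm (V × V)} (hu : Aff u)
    (H1 : ∀ a, ∃ a', u * trF h2 f hf a = trF h2 f hf a' * u)
    (H1' : ∀ a', ∃ a, u * trF h2 f hf a = trF h2 f hf a' * u) (y : V) :
    (LinP u (0, y)).1 = 0 := by
  have key : ∀ a, QB f a (LinP u (0, y)).1 = 0 := by
    intro a
    obtain ⟨c, hcc⟩ := H1' a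
    have h := congrArg (fun e => LinP e ((0 : V), y)) hcc
    simp only [LinP_mul (prod_ch2 h2) hu, LinP_mul (prod_ch2 h2) (Aff.trF h2 f hf a), LinP_trF] at h
    rw [hf.zero_right h2, add_zero] at h
    have h3 := congrArg Prod.snd h
    simp only at h3
    exact (left_eq_add.mp h3)
  by_contra hz
  have : (Set.univ : Set V) ⊆ {0, (LinP u (0, y)).1} := by
    intro a _
    by_cases ha : a = 0
    · simp [ha]
    · rcases hf.apn a _ ha (key a) with h | h
      · exact absurd h hz
      · simp [h]
  have h3 := Set.ncard_le_ncard this (Set.toFinite _)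
  rw [Set.ncard_univ] at h3
  have h4 := (Set.ncard_insert_le (0 : V) {(LinP u (0, y)).1})
  rw [Set.ncard_singleton] at h4
  omega

lemma core_lin (h2 : ∀ x : V, x + x = 0) {f : V → V} (hf : QuadAPN f)
    {u : Equiv.Perm (V × V)} (hu : Aff u) (hg : GM f f u)
    (hM : ∀ x, (LinP u (x, 0)).1 = x) (hN : ∀ y, LinP u (0, y) = (0, y)) :
    u = trF h2 f hf (u 0).1 := by
  have h00 : (u 0).2 = f (u 0).1 := (hg 0).mp hf.zero.symm
  have hs : ∀ x, (LinP u (x, 0)).2 = QB f (u 0).1 x := by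
    intro x
    have h1 := (hg (x, f x)).mp rfl
    rw [LinP_apply (prod_ch2 h2) u (x, f x)] at h1
    have h3 : LinP u (x, f x) = LinP u (x, 0) + (0, f x) := by
      rw [← hN (f x), ← LinP_add (prod_ch2 h2) hu]; simp
    rw [h3] at h1
    simp only [Prod.fst_add, Prod.snd_add, hM, add_zero, h00] at h1
    have h4 := QB_expand h2 f (u 0).1 x
    rw [add_comm x, h4] at h1
    have h5 : (LinP u (x, 0)).2 + (f x + f (u 0).1) = QB f (u 0).1 x + (f x + f (u 0).1) := by
      rw [← add_assoc, h1]; abel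
    exact add_right_cancel h5
  ext1 p
  rw [LinP_apply (prod_ch2 h2) u p, trF_apply]
  have h3 : LinP u p = LinP u (p.1, 0) + (0, p.2) := by
    rw [← hN p.2, ← LinP_add (prod_ch2 h2) hu]; simp
  rw [h3]
  ext
  · simp [hM]
  · simp only [Prod.snd_add, hs, h00]; abel

lemma ncard_insert_bound {W : Type*} [Finite W] (a : W) (s : Set W) (n : ℕ) (h : s.ncard ≤ n) :
    (insert a s).ncard ≤ n + 1 :=
  (Set.ncard_insert_le a s).trans (by omega)

lemma core_Y [Finite V] (h2 : ∀ x : V, x + x = 0) (hc : 16 ≤ Nat.card V) {f g : V → V}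
    (hf : QuadAPN f) (hg : QuadAPN g) {E : Equiv.Perm (V × V)} (hE : Aff E) (hG : GM f g E)
    (H1 : ∀ a b, ∃ a', (E⁻¹ * trF h2 g hg b * E) * trF h2 f hf a * (E⁻¹ * trF h2 g hg b * E)⁻¹
      = trF h2 f hf a')
    (H2 : ∀ a b, ∃ b', trF h2 f hf a * (E⁻¹ * trF h2 g hg b * E) * (trF h2 f hf a)⁻¹
      = E⁻¹ * trF h2 g hg b' * E) (b : V) :
    ∃ a, E⁻¹ * trF h2 g hg b * E = trF h2 f hf a := by
  have hinv : ∀ b, (E⁻¹ * trF h2 g hg b * E)⁻¹ = E⁻¹ * trF h2 g hg b * E := by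
    intro b; simp only [mul_inv_rev, inv_inv, trF_inv, mul_assoc]
  have huA : ∀ b, Aff (E⁻¹ * trF h2 g hg b * E) := fun b => (hE.inv.mul (Aff.trF h2 g hg b)).mul hE
  have huG : GM f f (E⁻¹ * trF h2 g hg b * E) := (hG.inv.mul (GM.trF h2 g hg b)).mul hG
  have hmulu : ∀ b b', (E⁻¹ * trF h2 g hg b * E) * (E⁻¹ * trF h2 g hg b' * E) =
      E⁻¹ * trF h2 g hg (b + b') * E := by
    intro b b'; rw [← trF_mul]; group
  have F : ∀ b p, LinP E (LinP (E⁻¹ * trF h2 g hg b * E) p) =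
      ((LinP E p).1, (LinP E p).2 + QB g b (LinP E p).1) := by
    intro b p
    rw [← LinP_mul (prod_ch2 h2) hE]
    have : E * (E⁻¹ * trF h2 g hg b * E) = trF h2 g hg b * E := by group
    rw [this, LinP_mul (prod_ch2 h2) (Aff.trF h2 g hg b), LinP_trF]
  have F1 : ∀ b p, (LinP E p).1 = 0 → LinP (E⁻¹ * trF h2 g hg b * E) p = p := by
    intro b p hp
    apply LinP_inj (e := E)
    rw [F, hp, hg.zero_right h2, add_zero]
    ext <;> simp [hp]
  have F2 : ∀ b p, (LinP E (LinP (E⁻¹ * trF h2 g hg b * E) p + p)).1 = 0 := by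
    intro b p
    rw [LinP_add (prod_ch2 h2) hE, F]
    simp [h2]
  set u := E⁻¹ * trF h2 g hg b * E with hu
  have huinv : u⁻¹ = u := hinv b
  have huu : u * u = 1 := by nth_rewrite 1 [← huinv]; simp
  have H1a : ∀ a, ∃ a', u * trF h2 f hf a = trF h2 f hf a' * u := by
    intro a
    obtain ⟨a', h⟩ := H1 a b
    exact ⟨a', by rw [← h, ← hu]; group⟩
  have H1b : ∀ a', ∃ a, u * trF h2 f hf a = trF h2 f hf a' * u := by
    intro a
    obtain ⟨a', h⟩ := H1 a b
    refine ⟨a', ?_⟩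
    rw [← h, ← hu]
    rw [← mul_assoc, ← mul_assoc, huu, one_mul, huinv]
  have h0 := core_h0 h2 hc hf (huA b) H1a H1b
  rw [← hu] at h0
  have hL := LinP_add (prod_ch2 h2) (huA b)
  rw [← hu] at hL
  have hQBi := QB_intertwine h2 hf hf (huA b) huG h0
  rw [← hu] at hQBi
  obtain ⟨M, hMdef⟩ : ∃ M : V → V, ∀ x, M x = (LinP u (x, 0)).1 := ⟨_, fun _ => rfl⟩
  obtain ⟨N, hNdef⟩ : ∃ N : V → V, ∀ x, N x = (LinP u (0, x)).2 := ⟨_, fun _ => rfl⟩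
  simp only [← hMdef, ← hNdef] at hQBi
  have hMa : ∀ x y, M (x + y) = M x + M y := by
    intro x y; rw [hMdef, hMdef, hMdef, ← Prod.fst_add, ← hL]; simp
  have hNa : ∀ x y, N (x + y) = N x + N y := by
    intro x y; rw [hNdef, hNdef, hNdef, ← Prod.snd_add, ← hL]; simp
  have hNL : ∀ y, LinP u (0, y) = (0, N y) := by
    intro y; ext
    · exact h0 y
    · exact (hNdef y).symm
  have hconj : ∀ c, u * trF h2 f hf c = trF h2 f hf (M c) * u := by
    intro c
    obtain ⟨a, ha⟩ := H1a c
    have h1 := congrArg (fun e : Equiv.Perm (V × V) => (e 0).1) ha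
    simp only [Equiv.Perm.mul_apply, trF_apply, Prod.fst_zero, Prod.snd_zero, zero_add,
      hf.zero_right h2] at h1
    rw [LinP_apply (prod_ch2 h2) u] at h1
    have h3 : LinP u (c, f c) = LinP u (c, 0) + (0, N (f c)) := by
      rw [← hNL, ← hL]; simp
    rw [h3] at h1
    simp only [Prod.fst_add, add_zero, ← hMdef] at h1
    rw [add_comm] at h1
    rw [add_left_cancel h1, ha]
  have hM1 : ∀ a, M a + a = 0 := by
    intro a
    by_contra he
    obtain ⟨b', hb'⟩ := H2 a b
    rw [trF_inv, ← hu] at hb'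
    have hte : trF h2 f hf (M a + a) = E⁻¹ * trF h2 g hg (b' + b) * E := by
      rw [← hmulu, ← hu, ← hb', add_comm, ← trF_mul, mul_assoc, mul_assoc, ← mul_assoc u, hconj,
        mul_assoc, huu, mul_one]
    set e := M a + a with hedef
    have W1 : ∀ x, (LinP E (0, QB f e x)).1 = 0 := by
      intro x
      have := F2 (b' + b) (x, 0)
      rw [← hte, LinP_trF] at this
      simpa [h2] using this
    have W2 : ∀ p : V × V, (LinP E p).1 = 0 → p.1 = 0 ∨ p.1 = e := by
      intro p hp
      have := F1 (b' + b) p hp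
      rw [← hte, LinP_trF] at this
      have h3 := congrArg Prod.snd this
      simp only [add_eq_left] at h3
      exact hf.apn e _ he h3
    have W3 : ∀ x, M x + x = 0 ∨ M x + x = e := by
      intro x
      have := W2 _ (F2 b (x, 0))
      rw [← hu] at this
      simpa [← hMdef] using this
    have W4 : ∀ x, N (QB f e x) = QB f e x := by
      intro x
      have := F1 b _ (W1 x)
      rw [← hu, hNL] at this
      exact congrArg Prod.snd this
    let he' : V →+ V := AddMonoidHom.mk' (QB f e) (hf.add_right e)
    obtain ⟨w, hw⟩ : ∃ w, ∀ y, N y + y = 0 ∨ N y + y = w := by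
      by_cases hr : ∀ y, y ∈ he'.range
      · refine ⟨0, fun y => Or.inl ?_⟩
        obtain ⟨x, hx⟩ := hr y
        have hx' : QB f e x = y := hx
        rw [← hx', W4, h2]
      · push Not at hr
        obtain ⟨y0, hy0⟩ := hr
        refine ⟨N y0 + y0, fun y => ?_⟩
        rcases idx_two he' e (fun x hx => hf.apn e x he hx) y y0 with h | h | h
        · left
          obtain ⟨x, hx⟩ := h
          have hx' : QB f e x = y := hx
          rw [← hx', W4, h2]
        · exact absurd h hy0
        · right
          obtain ⟨x, hx⟩ := h
          have hx' : QB f e x = y - y0 := hx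
          have hy : y = QB f e x + y0 := by rw [hx']; abel
          rw [hy, hNa, W4]
          calc _ = (QB f e x + QB f e x) + (N y0 + y0) := by abel
            _ = _ := by rw [h2, zero_add]
    have W5 : ∀ x, M x + x = 0 → QB f e x = 0 ∨ QB f e x = w := by
      intro x hx
      have hx' : M x = x := ch2_eq h2 hx
      have ha' : M a = a + e := by
        rw [hedef, add_comm (M a), ← add_assoc, h2, zero_add]
      have h3 := hQBi x a
      rw [hx', ha', hf.add_right] at h3
      have h4 := hw (QB f x a)
      rw [h3, QB_comm f x e] at h4
      have h5 : QB f x a + QB f e x + QB f x a = QB f e x := by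
        rw [add_comm, ← add_assoc, h2, zero_add]
      rwa [h5] at h4
    obtain ⟨x0, hx0⟩ : ∃ x0, ∀ x, QB f e x = w → x = x0 ∨ x = x0 + e := by
      by_cases hr : ∃ x0, QB f e x0 = w
      · obtain ⟨x0, hx0⟩ := hr
        refine ⟨x0, fun x hx => ?_⟩
        have h3 : QB f e (x0 + x) = 0 := by rw [hf.add_right, hx0, hx, h2]
        rcases hf.apn e _ he h3 with h | h
        · exact Or.inl (ch2_eq h2 h).symm
        · right
          rw [← h, ← add_assoc, h2, zero_add]
      · exact ⟨0, fun x hx => absurd ⟨x, hx⟩ hr⟩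
    have W6 : ∀ x, M x + x = 0 → x = 0 ∨ x = e ∨ x = x0 ∨ x = x0 + e := by
      intro x hx
      rcases W5 x hx with h | h
      · rcases hf.apn e _ he h with h | h <;> simp [h]
      · rcases hx0 x h with h | h <;> simp [h]
    have hsub : (Set.univ : Set V) ⊆ {0, e, x0, x0 + e, a, e + a, x0 + a, x0 + e + a} := by
      intro x _
      rcases W3 x with h | h
      · rcases W6 x h with h | h | h | h <;> simp [h]
      · have h3 : M (x + a) + (x + a) = 0 := by
          rw [hMa]
          calc _ = (M x + x) + (M a + a) := by abel
            _ = 0 := by rw [h, ← hedef, h2]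
        have hxx : x = (x + a) + a := by rw [add_assoc, h2, add_zero]
        rcases W6 _ h3 with h | h | h | h <;> rw [h] at hxx <;> simp [hxx]
    have h3 := Set.ncard_le_ncard hsub (Set.toFinite _)
    rw [Set.ncard_univ] at h3
    have h4 : ({0, e, x0, x0 + e, a, e + a, x0 + a, x0 + e + a} : Set V).ncard ≤ 8 := by
      iterate 7 apply ncard_insert_bound
      rw [Set.ncard_singleton]
    omega
  have hM2 : ∀ x, M x = x := fun x => ch2_eq h2 (hM1 x)
  have hN2 : ∀ y, N y = y := by
    let H : AddSubgroup V :=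
      { carrier := {y | N y = y}
        zero_mem' := by
          have := hNa 0 0
          simpa using this
        add_mem' := by
          intro x y hx hy
          have hx' : N x = x := hx
          have hy' : N y = y := hy
          change N (x + y) = x + y
          rw [hNa, hx', hy']
        neg_mem' := by
          intro x hx
          rw [ch2_neg h2]; exact hx }
    have hH := hf.span H (fun x y => by
      change N (QB f x y) = QB f x y
      rw [hQBi, hM2, hM2])
    intro y
    have : y ∈ H := by rw [hH]; trivial
    exact this
  exact ⟨_, core_lin h2 hf (huA b) huG (fun x => by rw [← hMdef, hM2])
    (fun y => by rw [hNL, hN2])⟩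

end Yoshiara2


section Yoshiara3

variable {V : Type*} [AddCommGroup V]

/-- affine automorphisms of the graph of `f` -/
def GrAut (f : V → V) : Subgroup (Equiv.Perm (V × V)) where
  carrier := {e | Aff e ∧ GM f f e}
  one_mem' := ⟨Aff.one, GM.one⟩
  mul_mem' := fun ha hb => ⟨ha.1.mul hb.1, ha.2.mul hb.2⟩
  inv_mem' := fun ha => ⟨ha.1.inv, ha.2.inv⟩

lemma mem_GrAut (h2 : ∀ x : V, x + x = 0) {f g : V → V} (hg : QuadAPN g)
    {E : Equiv.Perm (V × V)} (hE : Aff E) (hG : GM f g E) (a : V) :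
    E⁻¹ * trF h2 g hg a * E ∈ GrAut f :=
  ⟨(hE.inv.mul (Aff.trF h2 g hg a)).mul hE, (hG.inv.mul (GM.trF h2 g hg a)).mul hG⟩

/-- the family of translation subgroups -/
def TrFam (h2 : ∀ x : V, x + x = 0) (f : V → V) : Set (Subgroup (GrAut f)) :=
  {T | ∃ (g : V → V) (hg : QuadAPN g) (E : Equiv.Perm (V × V)), Aff E ∧ GM f g E ∧
    ∀ x : GrAut f, x ∈ T ↔ ∃ a, (x : Equiv.Perm (V × V)) = E⁻¹ * trF h2 g hg a * E}

lemma TrFam_le [Finite V] (h2 : ∀ x : V, x + x = 0) (hc : 16 ≤ Nat.card V) {f : V → V}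
    {T T' : Subgroup (GrAut f)} (hT : T ∈ TrFam h2 f) (hT' : T' ∈ TrFam h2 f)
    (m1 : ∀ t ∈ T, ∀ u ∈ T', t * u * t⁻¹ ∈ T') (m2 : ∀ t ∈ T, ∀ u ∈ T', u * t * u⁻¹ ∈ T) :
    T' ≤ T := by
  obtain ⟨g1, hg1, E1, hE1, hG1, hT⟩ := hT
  obtain ⟨g2, hg2, E2, hE2, hG2, hT'⟩ := hT'
  have hA : Aff (E2 * E1⁻¹) := hE2.mul hE1.inv
  have hGM : GM g1 g2 (E2 * E1⁻¹) := hG2.mul hG1.inv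
  have e1 : ∀ b, (E2 * E1⁻¹)⁻¹ * trF h2 g2 hg2 b * (E2 * E1⁻¹) =
      E1 * (E2⁻¹ * trF h2 g2 hg2 b * E2) * E1⁻¹ := by intro b; group
  have core := core_Y h2 hc hg1 hg2 hA hGM (by
    intro a b
    have h := m2 ⟨_, mem_GrAut h2 hg1 hE1 hG1 a⟩ ((hT _).mpr ⟨a, rfl⟩)
      ⟨_, mem_GrAut h2 hg2 hE2 hG2 b⟩ ((hT' _).mpr ⟨b, rfl⟩)
    obtain ⟨a', ha'⟩ := (hT _).mp h
    refine ⟨a', ?_⟩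
    simp only [Subgroup.coe_mul, Subgroup.coe_inv] at ha'
    rw [e1]
    calc _ = E1 * ((E2⁻¹ * trF h2 g2 hg2 b * E2) * (E1⁻¹ * trF h2 g1 hg1 a * E1) *
            (E2⁻¹ * trF h2 g2 hg2 b * E2)⁻¹) * E1⁻¹ := by group
      _ = _ := by rw [ha']; group) (by
    intro a b
    have h := m1 ⟨_, mem_GrAut h2 hg1 hE1 hG1 a⟩ ((hT _).mpr ⟨a, rfl⟩)
      ⟨_, mem_GrAut h2 hg2 hE2 hG2 b⟩ ((hT' _).mpr ⟨b, rfl⟩)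
    obtain ⟨b', hb'⟩ := (hT' _).mp h
    refine ⟨b', ?_⟩
    simp only [Subgroup.coe_mul, Subgroup.coe_inv] at hb'
    rw [e1, e1]
    rw [← hb']
    group)
  intro x hx
  obtain ⟨b, hb⟩ := (hT' x).mp hx
  obtain ⟨a, ha⟩ := core b
  refine (hT x).mpr ⟨a, ?_⟩
  rw [hb, ← ha]; group

lemma exists_EA [Finite V] (h2 : ∀ x : V, x + x = 0) (hc : 16 ≤ Nat.card V) {f g : V → V}
    (hf : QuadAPN f) (hg : QuadAPN g) {E : Equiv.Perm (V × V)} (hE : Aff E) (hG : GM f g E) :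
    ∃ M N : V →+ V, Function.Injective M ∧ Function.Injective N ∧
      ∀ x y, N (QB f x y) = QB g (M x) (M y) := by
  let mk : ∀ (g : V → V) (hg : QuadAPN g) (E : Equiv.Perm (V × V)), Subgroup (GrAut f) :=
    fun g hg E =>
    { carrier := {x | ∃ a, (x : Equiv.Perm (V × V)) = E⁻¹ * trF h2 g hg a * E}
      one_mem' := ⟨0, by rw [trF_zero]; simp⟩
      mul_mem' := by
        rintro x y ⟨a, ha⟩ ⟨b, hb⟩
        refine ⟨a + b, ?_⟩
        rw [Subgroup.coe_mul, ha, hb, ← trF_mul]; group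
      inv_mem' := by
        rintro x ⟨a, ha⟩
        refine ⟨a, ?_⟩
        rw [Subgroup.coe_inv, ha]
        simp only [mul_inv_rev, inv_inv, trF_inv, mul_assoc] }
  have hTf : mk f hf 1 ∈ TrFam h2 f := ⟨f, hf, 1, Aff.one, GM.one, fun x => Iff.rfl⟩
  have hTg : mk g hg E ∈ TrFam h2 f := ⟨g, hg, E, hE, hG, fun x => Iff.rfl⟩
  have : Fact (Nat.Prime 2) := ⟨Nat.prime_two⟩
  obtain ⟨s, hs⟩ := conj_of_mutual (p := 2) (TrFam h2 f) (by
      rintro T ⟨g, hg, E, hE, hG, hT⟩ ⟨x, hx⟩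
      refine ⟨1, ?_⟩
      obtain ⟨a, ha⟩ := (hT x).mp hx
      apply Subtype.ext
      apply Subtype.ext
      simp only [pow_one, pow_two, Subgroup.coe_mul, Subgroup.coe_one, ha]
      calc _ = E⁻¹ * (trF h2 g hg a * trF h2 g hg a) * E := by group
        _ = 1 := by rw [trF_mul, h2, trF_zero]; group) (by
      rintro T ⟨g, hg, E, hE, hG, hT⟩ s
      refine ⟨g, hg, E * (s : Equiv.Perm (V × V))⁻¹, hE.mul s.2.1.inv, hG.mul s.2.2.inv, ?_⟩
      intro x
      rw [Subgroup.mem_map]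
      constructor
      · rintro ⟨t, ht, rfl⟩
        obtain ⟨a, ha⟩ := (hT t).mp ht
        refine ⟨a, ?_⟩
        simp [ha, mul_assoc]
      · rintro ⟨a, ha⟩
        refine ⟨s⁻¹ * x * s, (hT _).mpr ⟨a, ?_⟩, ?_⟩
        · simp only [Subgroup.coe_mul, Subgroup.coe_inv, ha]; group
        · simp [mul_assoc]) (by
      intro T hT T' hT' m1 m2
      exact le_antisymm (TrFam_le h2 hc hT' hT (fun t ht u hu => m2 u hu t ht) (fun t ht u hu => m1 u hu t ht)) (TrFam_le h2 hc hT hT' m1 m2))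
    _ hTf _ hTg
  set D : Equiv.Perm (V × V) := E * (s : Equiv.Perm (V × V))⁻¹ with hD
  have hDA : Aff D := hE.mul s.2.1.inv
  have hDG : GM f g D := hG.mul s.2.2.inv
  have hconj : ∀ b, ∃ a, trF h2 g hg b = D * trF h2 f hf a * D⁻¹ := by
    intro b
    have h1 : (⟨_, mem_GrAut h2 hg hE hG b⟩ : GrAut f) ∈ mk g hg E := ⟨b, rfl⟩
    have h3 := Subgroup.mem_map_of_mem (MulAut.conj s).toMonoidHom h1
    rw [← hs] at h3
    obtain ⟨a, ha⟩ := h3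
    refine ⟨a, ?_⟩
    simp at ha
    rw [← ha, hD]
    group
  have h0 : ∀ y, (LinP D (0, y)).1 = 0 := by
    intro y
    have key : ∀ b, QB g b (LinP D (0, y)).1 = 0 := by
      intro b
      obtain ⟨a, ha⟩ := hconj b
      have ha' : D * trF h2 f hf a = trF h2 g hg b * D := by rw [ha]; group
      have h := congrArg (fun e => LinP e ((0 : V), y)) ha'
      simp only [LinP_mul (prod_ch2 h2) hDA, LinP_mul (prod_ch2 h2) (Aff.trF h2 g hg b), LinP_trF] at h
      rw [hf.zero_right h2, add_zero] at h
      have h3 := congrArg Prod.snd h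
      simp only at h3
      exact (left_eq_add.mp h3)
    by_contra hz
    have : (Set.univ : Set V) ⊆ {0, (LinP D (0, y)).1} := by
      intro a _
      by_cases ha : a = 0
      · simp [ha]
      · rcases hg.apn a _ ha (key a) with h | h
        · exact absurd h hz
        · simp [h]
    have h3 := Set.ncard_le_ncard this (Set.toFinite _)
    rw [Set.ncard_univ] at h3
    have h4 := (Set.ncard_insert_le (0 : V) {(LinP D (0, y)).1})
    rw [Set.ncard_singleton] at h4
    omega
  have hQBi := QB_intertwine h2 hf hg hDA hDG h0
  have hL := LinP_add (prod_ch2 h2) hDA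
  let M : V →+ V := AddMonoidHom.mk' (fun x => (LinP D (x, 0)).1) (by
    intro x y; rw [← Prod.fst_add, ← hL]; simp)
  let N : V →+ V := AddMonoidHom.mk' (fun x => (LinP D (0, x)).2) (by
    intro x y; rw [← Prod.snd_add, ← hL]; simp)
  have hNinj : Function.Injective N := by
    rw [injective_iff_map_eq_zero]
    intro y hy
    have : LinP D (0, y) = LinP D 0 := by
      rw [LinP_zero (prod_ch2 h2)]
      ext
      · exact h0 y
      · exact hy
    exact congrArg Prod.snd (LinP_inj this)
  refine ⟨M, N, ?_, hNinj, hQBi⟩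
  rw [injective_iff_map_eq_zero]
  intro x hx
  have hx' : (LinP D (x, 0)).1 = 0 := hx
  obtain ⟨y, hy⟩ := (Finite.injective_iff_surjective.mp hNinj) (LinP D (x, 0)).2
  have : LinP D (x, 0) = LinP D (0, y) := by
    ext
    · rw [hx', h0]
    · exact hy.symm
  exact congrArg Prod.fst (LinP_inj this)

lemma ccz_EA {V : Type*} [AddCommGroup V] [Module (ZMod 2) V] [Finite V] (hc : 16 ≤ Nat.card V)
    {f g : V → V} (hf : QuadAPN f) (hg : QuadAPN g) (h : CCZEquivalent f g) :
    ∃ M N : V →+ V, Function.Injective M ∧ Function.Injective N ∧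
      ∀ x y, N (QB f x y) = QB g (M x) (M y) := by
  have h2 : ∀ x : V, x + x = 0 := fun x => ZModModule.add_self x
  obtain ⟨A, c, hA, hbij, him⟩ := h
  let E : Equiv.Perm (V × V) := (Equiv.ofBijective A hbij).trans (Equiv.addRight c)
  have hEa : ∀ p, E p = A p + c := fun p => rfl
  apply exists_EA h2 hc hf hg (E := E)
  · intro p q r
    simp only [hEa, hA.map_add]
    have := prod_ch2 h2 c
    calc _ = A p + A q + A r + (c + c) + c := by rw [this]; abel
      _ = _ := by abel
  · intro p
    constructor
    · intro hp
      have : E p ∈ (fun p => A p + c) '' {p : V × V | p.2 = f p.1} := ⟨p, hp, rfl⟩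
      rw [him] at this
      exact this
    · intro hp
      have : E p ∈ {p : V × V | p.2 = g p.1} := hp
      rw [← him] at this
      obtain ⟨q, hq, hqp⟩ := this
      have : E q = E p := hqp
      rw [← E.injective this]
      exact hq

end Yoshiara3


section Linearized

variable {K : Type*} [Field K] [CharP K 2] {m : ℕ}

/-- the Frobenius power `x ↦ x ^ 2 ^ i`, indexed by `ZMod m` -/
def Ph (i : ZMod m) : K →+* K := iterateFrobenius K 2 i.val

lemma Ph_apply (i : ZMod m) (x : K) : Ph i x = x ^ 2 ^ i.val := by
  simp [Ph, iterateFrobenius_def]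

lemma pow_card2 (hK : Nat.card K = 2 ^ m) (x : K) : x ^ 2 ^ m = x := by
  have : 0 < Nat.card K := by rw [hK]; positivity
  have : Finite K := Nat.finite_of_card_ne_zero (by omega)
  have : Fintype K := Fintype.ofFinite K
  rw [← hK, Nat.card_eq_fintype_card, FiniteField.pow_card]

lemma pow_add_mul (hK : Nat.card K = 2 ^ m) (x : K) (a b : ℕ) : x ^ 2 ^ (a + m * b) = x ^ 2 ^ a := by
  induction b with
  | zero => simp
  | succ b ih =>
    rw [Nat.mul_succ, ← add_assoc, pow_add 2 _ m, pow_mul, pow_card2 hK, ih]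

lemma pow_mod (hK : Nat.card K = 2 ^ m) (x : K) (a : ℕ) : x ^ 2 ^ (a % m) = x ^ 2 ^ a := by
  conv_rhs => rw [← Nat.mod_add_div a m]
  rw [pow_add_mul hK]

lemma Ph_natCast (hK : Nat.card K = 2 ^ m) (k : ℕ) (x : K) : Ph (k : ZMod m) x = x ^ 2 ^ k := by
  rw [Ph_apply, ZMod.val_natCast, pow_mod hK]

lemma Ph_add [NeZero m] (hK : Nat.card K = 2 ^ m) (i j : ZMod m) (x : K) : Ph (i + j) x = Ph i (Ph j x) := by
  rw [Ph_apply, Ph_apply, Ph_apply, ZMod.val_add, pow_mod hK, ← pow_mul, ← pow_add, add_comm]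

lemma Ph_zero [NeZero m] (x : K) : Ph (0 : ZMod m) x = x := by
  rw [Ph_apply]; simp

lemma Ph_inj (i : ZMod m) {x y : K} (h : Ph i x = Ph i y) : x = y := (Ph (K := K) i).injective h

lemma Ph_eq_zero (i : ZMod m) {x : K} : Ph i x = 0 ↔ x = 0 := map_eq_zero _

lemma Ph_neg_cancel [NeZero m] (hK : Nat.card K = 2 ^ m) (i : ZMod m) (x : K) : Ph i (Ph (-i) x) = x := by
  rw [← Ph_add hK, add_neg_cancel, Ph_zero]

lemma Ph_index_inj [NeZero m] (hK : Nat.card K = 2 ^ m) (i j : ZMod m)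
    (h : ∀ x : K, Ph i x = Ph j x) : i = j := by
  have hpos : 0 < Nat.card K := by rw [hK]; positivity
  have : Finite K := Nat.finite_of_card_ne_zero (by omega)
  have hd : ∀ x : K, Ph (i - j) x = x := by
    intro x
    have := h (Ph (-j) x)
    rw [Ph_neg_cancel hK, ← Ph_add hK] at this
    rw [sub_eq_add_neg]; exact this
  obtain ⟨g, hg⟩ := IsCyclic.exists_generator (α := Kˣ)
  have ho : orderOf g = 2 ^ m - 1 := by
    rw [orderOf_eq_card_of_forall_mem_zpowers hg, Nat.card_units, hK]
  have h1 := hd g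
  rw [Ph_apply] at h1
  have hp : 0 < 2 ^ (i - j).val := by positivity
  have h3 : g ^ (2 ^ (i - j).val - 1) = 1 := by
    have h4 : g ^ 2 ^ (i - j).val = g := by ext; simpa using h1
    have : g ^ (2 ^ (i - j).val - 1) * g = 1 * g := by
      rw [← pow_succ, Nat.sub_add_cancel hp, h4, one_mul]
    exact mul_right_cancel this
  have h4 := orderOf_dvd_of_pow_eq_one h3
  rw [ho] at h4
  have h5 : (2 : ℕ) ^ (i - j).val < 2 ^ m := Nat.pow_lt_pow_right (by norm_num) (ZMod.val_lt _)
  have h6 : 2 ^ (i - j).val - 1 = 0 := Nat.eq_zero_of_dvd_of_lt h4 (by omega)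
  have h7 : (i - j).val = 0 := by
    by_contra h
    have := Nat.one_lt_two_pow h
    omega
  rw [ZMod.val_eq_zero] at h7
  exact sub_eq_zero.mp h7

lemma lin_indep [NeZero m] (hK : Nat.card K = 2 ^ m) (l : ZMod m → K)
    (h : ∀ x : K, ∑ i, l i * Ph i x = 0) (i : ZMod m) : l i = 0 := by
  have h1 := linearIndependent_monoidHom K K
  have hinj : Function.Injective (fun i : ZMod m => ((Ph i : K →+* K) : K →* K)) := by
    intro i j hij
    apply Ph_index_inj hK
    intro x
    exact DFunLike.congr_fun hij x
  have h3 := h1.comp _ hinj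
  rw [Fintype.linearIndependent_iff] at h3
  refine h3 l ?_ i
  funext x
  have := h x
  simpa [Finset.sum_apply] using this

lemma lin_exists [NeZero m] (hK : Nat.card K = 2 ^ m) (L : K →+ K) :
    ∃ l : ZMod m → K, ∀ x, L x = ∑ i, l i * Ph i x := by
  have hpos : 0 < Nat.card K := by rw [hK]; positivity
  have : Finite K := Nat.finite_of_card_ne_zero (by omega)
  let _ := ZMod.algebra K 2
  let T : (ZMod m → K) → (K →ₗ[ZMod 2] K) := fun l =>
    AddMonoidHom.toZModLinearMap 2 (AddMonoidHom.mk' (fun x => ∑ i, l i * Ph i x) (by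
      intro x y
      rw [← Finset.sum_add_distrib]
      apply Finset.sum_congr rfl
      intro i _
      rw [map_add]; ring))
  have hT : ∀ l x, T l x = ∑ i, l i * Ph i x := fun l x => rfl
  have hinj : Function.Injective T := by
    intro l l' h
    funext i
    rw [← sub_eq_zero]
    refine lin_indep hK (fun i => l i - l' i) ?_ i
    intro x
    have h1 := DFunLike.congr_fun h x
    rw [hT, hT] at h1
    simp only [sub_mul]
    rw [Finset.sum_sub_distrib, h1, sub_self]
  have hfin : Finite (K →ₗ[ZMod 2] K) := Module.finite_of_finite (ZMod 2)
  have hfr : Module.finrank (ZMod 2) K = m := by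
    have h := Module.natCard_eq_pow_finrank (K := ZMod 2) (V := K)
    rw [hK, Nat.card_zmod] at h
    exact (Nat.pow_right_injective le_rfl h).symm
  have hcard : Nat.card (ZMod m → K) = Nat.card (K →ₗ[ZMod 2] K) := by
    rw [Module.natCard_eq_pow_finrank (K := ZMod 2) (V := (K →ₗ[ZMod 2] K)),
      Module.finrank_linearMap, hfr, Nat.card_fun, hK, Nat.card_zmod, Nat.card_zmod, ← pow_mul]
  have hbij := (Nat.bijective_iff_injective_and_card T).mpr ⟨hinj, hcard⟩
  obtain ⟨l, hl⟩ := hbij.2 (AddMonoidHom.toZModLinearMap 2 L)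
  refine ⟨l, fun x => ?_⟩
  rw [← hT, hl]; rfl

/-- `c` is the coefficient matrix of the biadditive map `F` -/
def BRep [NeZero m] (F : K → K → K) (c : ZMod m → ZMod m → K) : Prop :=
  ∀ x u, F x u = ∑ r, ∑ s, c r s * Ph r x * Ph s u

lemma BRep.unique [NeZero m] (hK : Nat.card K = 2 ^ m) {F G : K → K → K} {c d : ZMod m → ZMod m → K}
    (hc : BRep F c) (hd : BRep G d) (h : ∀ x u, F x u = G x u) (r s : ZMod m) : c r s = d r s := by
  rw [← sub_eq_zero]
  refine lin_indep hK (fun s => c r s - d r s) ?_ s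
  intro u
  refine lin_indep hK (fun r => ∑ s, (c r s - d r s) * Ph s u) ?_ r
  intro x
  have h1 := h x u
  rw [hc, hd, ← sub_eq_zero, ← Finset.sum_sub_distrib] at h1
  rw [← h1]
  apply Finset.sum_congr rfl
  intro r _
  rw [Finset.sum_mul, ← Finset.sum_sub_distrib]
  apply Finset.sum_congr rfl
  intro s _
  ring

lemma BRep.add [NeZero m] {F G : K → K → K} {c d : ZMod m → ZMod m → K}
    (hc : BRep F c) (hd : BRep G d) : BRep (fun x u => F x u + G x u) (fun r s => c r s + d r s) := by
  intro x u
  simp only [hc x u, hd x u, add_mul, Finset.sum_add_distrib]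

lemma BRep.prod [NeZero m] {A C : K → K} {a c : ZMod m → K}
    (hA : ∀ x, A x = ∑ i, a i * Ph i x) (hC : ∀ x, C x = ∑ i, c i * Ph i x) :
    BRep (fun x u => A x * C u) (fun r s => a r * c s) := by
  intro x u
  simp only [hA x, hC u, Finset.sum_mul_sum]
  refine Finset.sum_congr rfl fun r _ => Finset.sum_congr rfl fun s _ => ?_
  ring

lemma BRep.mono [NeZero m] (c : K) (p q : ZMod m) :
    BRep (fun x u => c * Ph p x * Ph q u) (fun r s => if r = p ∧ s = q then c else 0) := by
  intro x u
  simp only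
  rw [Finset.sum_eq_single p, Finset.sum_eq_single q]
  · simp
  · intro s _ hs; simp [hs]
  · simp
  · intro r _ hr
    apply Finset.sum_eq_zero
    intro s _; simp [hr]
  · simp

lemma BRep.diag [NeZero m] (hK : Nat.card K = 2 ^ m) {n : K → K} {t : ZMod m → K}
    (hn : ∀ x, n x = ∑ i, t i * Ph i x) (c : K) (p q : ZMod m) :
    BRep (fun x u => n (c * Ph p x * Ph q u))
      (fun r s => if r - p = s - q then t (r - p) * Ph (r - p) c else 0) := by
  intro x u
  simp only [hn]
  rw [← Equiv.sum_comp (Equiv.subRight p)]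
  refine Finset.sum_congr rfl fun r _ => ?_
  simp only [Equiv.subRight_apply]
  rw [Finset.sum_eq_single (r - p + q)]
  · simp only [add_sub_cancel_right, if_true, map_mul]
    rw [← Ph_add hK, ← Ph_add hK, sub_add_cancel]
    ring
  · intro s _ hs
    rw [if_neg, zero_mul, zero_mul]
    intro h
    apply hs
    rw [h, sub_add_cancel]
  · simp

end Linearized


section TanForm

variable {K : Type*} [Field K] [CharP K 2] {m : ℕ}

/-- Taniguchi function in Frobenius-power form -/
def TF (κ : ZMod m) (α β : K) : K × K → K × K :=
  fun p => (Ph (3 * κ) p.1 * Ph (2 * κ) p.1 + α * Ph (2 * κ) p.1 * Ph κ p.2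
    + β * p.2 * Ph κ p.2, p.1 * p.2)

lemma tan_eq_TF (hK : Nat.card K = 2 ^ m) (k : ℕ) (α β : K) :
    taniguchi k α β = TF (k : ZMod m) α β := by
  funext p
  have h2 : (2 * (k : ZMod m)) = ((2 * k : ℕ) : ZMod m) := by push_cast; ring
  have h3 : (3 * (k : ZMod m)) = ((3 * k : ℕ) : ZMod m) := by push_cast; ring
  unfold taniguchi TF
  rw [h2, h3, Ph_natCast hK, Ph_natCast hK, Ph_natCast hK]
  ext
  · simp only
    rw [show 2 ^ (2 * k) * (2 ^ k + 1) = 2 ^ (3 * k) + 2 ^ (2 * k) by rw [show 3 * k = 2 * k + k by ring, pow_add]; ring,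
      pow_add p.1, pow_succ p.2]
    ring
  · rfl

lemma QB_TF (κ : ZMod m) (α β : K) (x y u v : K) :
    QB (TF κ α β) (x, y) (u, v) =
      (Ph (3 * κ) x * Ph (2 * κ) u + Ph (2 * κ) x * Ph (3 * κ) u
        + α * (Ph (2 * κ) x * Ph κ v + Ph (2 * κ) u * Ph κ y)
        + β * (y * Ph κ v + v * Ph κ y), x * v + y * u) := by
  have h2 : (2 : K) = 0 := CharTwo.two_eq_zero
  unfold QB TF
  ext
  · simp only [Prod.mk_add_mk, map_add]
    linear_combination (Ph (3 * κ) x * Ph (2 * κ) x + Ph (3 * κ) u * Ph (2 * κ) u +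
      α * Ph (2 * κ) x * Ph κ y + α * Ph (2 * κ) u * Ph κ v + β * y * Ph κ y + β * v * Ph κ v) * h2
  · simp only [Prod.mk_add_mk]
    linear_combination (x * y + u * v) * h2

lemma prodK_ch2 (p : K × K) : p + p = 0 := by
  ext <;> simp [CharTwo.add_self_eq_zero]

lemma TF_apn_aux [NeZero m] (hK : Nat.card K = 2 ^ m) {κ : ZMod m} {α β : K} (hβ : β ≠ 0)
    (hroot : ∀ z : K, Ph κ z * z + α * z + β ≠ 0) (hfix : ∀ x : K, Ph κ x = x → x = 0 ∨ x = 1)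
    (x y lam : K) (h0 : (x, y) ≠ (0, 0))
    (h : (QB (TF κ α β) (x, y) (lam * x, lam * y)).1 = 0) : lam = 0 ∨ lam = 1 := by
  have h2 : (2 : K) = 0 := CharTwo.two_eq_zero
  rw [QB_TF] at h
  simp only [map_mul] at h
  have e2 : ∀ z : K, Ph (2 * κ) z = Ph κ (Ph κ z) := by
    intro z; rw [two_mul, Ph_add hK]
  have e3 : ∀ z : K, Ph (3 * κ) z = Ph κ (Ph (2 * κ) z) := by
    intro z; rw [← Ph_add hK]; congr 1; ring
  apply hfix
  by_contra hmu
  have hmu' : lam + Ph κ lam ≠ 0 := by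
    intro hh; apply hmu
    linear_combination hh - lam * h2
  set μ := lam + Ph κ lam with hμ
  have hP : Ph κ μ = Ph κ lam + Ph (2 * κ) lam := by rw [hμ, map_add, e2]
  have hPP : Ph κ (Ph κ μ) = Ph (2 * κ) lam + Ph (3 * κ) lam := by rw [hP, map_add, e3, e2]
  set X := Ph (2 * κ) x with hX
  have h' : Ph κ X * X * Ph κ (Ph κ μ) + α * X * Ph κ y * Ph κ μ + β * y * Ph κ y * μ = 0 := by
    rw [hPP, hP, hμ, hX, ← e3]
    linear_combination h
  have hPμ : Ph κ μ ≠ 0 := by rwa [Ne, Ph_eq_zero]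
  have hPPμ : Ph κ (Ph κ μ) ≠ 0 := by rwa [Ne, Ph_eq_zero]
  by_cases hy : y = 0
  · rw [hy] at h'
    simp only [map_zero, mul_zero, zero_mul, add_zero] at h'
    have : X = 0 := by
      rcases mul_eq_zero.mp h' with h | h
      · rcases mul_eq_zero.mp h with h | h
        · rwa [Ph_eq_zero] at h
        · exact h
      · exact absurd h hPPμ
    rw [hX, Ph_eq_zero] at this
    exact h0 (by rw [this, hy])
  · have hPy : Ph κ y ≠ 0 := by rwa [Ne, Ph_eq_zero]
    apply hroot (X * Ph κ μ / (μ * y))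
    rw [map_div₀, map_mul, map_mul]
    field_simp
    linear_combination h'

lemma TF_quad [NeZero m] (hK : Nat.card K = 2 ^ m) {κ : ZMod m} {α β : K} (hβ : β ≠ 0)
    (hroot : ∀ z : K, Ph κ z * z + α * z + β ≠ 0) (hfix : ∀ x : K, Ph κ x = x → x = 0 ∨ x = 1)
    (h2κ : 2 * κ ≠ 0) :
    QuadAPN (TF κ α β) where
  zero := by simp [TF]
  add := by
    rintro ⟨x, y⟩ ⟨x', y'⟩ ⟨u, v⟩
    rw [Prod.mk_add_mk, QB_TF, QB_TF, QB_TF, Prod.mk_add_mk]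
    ext
    · simp only [map_add]; ring
    · simp only; ring
  apn := by
    have h2 : (2 : K) = 0 := CharTwo.two_eq_zero
    rintro ⟨x, y⟩ ⟨u, v⟩ h0 h
    have hs : x * v + y * u = 0 := by
      have := congrArg Prod.snd h
      rw [QB_TF] at this
      exact this
    obtain ⟨lam, hu, hv⟩ : ∃ lam, u = lam * x ∧ v = lam * y := by
      by_cases hx : x = 0
      · have hy : y ≠ 0 := by rintro rfl; exact h0 (by rw [hx]; rfl)
        refine ⟨v / y, ?_, ?_⟩
        · rw [hx] at hs ⊢
          have : y * u = 0 := by linear_combination hs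
          simpa [hy] using this
        · field_simp
      · refine ⟨u / x, ?_, ?_⟩
        · field_simp
        · field_simp
          linear_combination hs - u * y * h2
    have h1 := congrArg Prod.fst h
    rw [hu, hv] at h1
    rcases TF_apn_aux hK hβ hroot hfix x y lam h0 h1 with h | h
    · left; rw [hu, hv, h]; simp
    · right; rw [hu, hv, h]; simp
  span := by
    intro H hH
    by_contra hne
    let _ := ZMod.algebra K 2
    have hlt : AddSubgroup.toZModSubmodule 2 H < ⊤ := by
      rw [lt_top_iff_ne_top]
      intro h
      apply hne
      ext p
      have : p ∈ AddSubgroup.toZModSubmodule 2 H := by rw [h]; trivial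
      simpa using this
    obtain ⟨ψ, hψ0, hψ⟩ := Submodule.exists_le_ker_of_lt_top _ hlt
    have hψ' : ∀ p ∈ H, ψ p = 0 := fun p hp => hψ hp
    let c : ZMod 2 →+ K := (algebraMap (ZMod 2) K : ZMod 2 →+ K)
    have hc : Function.Injective c := (algebraMap (ZMod 2) K).injective
    let L1 : K →+ K := c.comp (ψ.toAddMonoidHom.comp (AddMonoidHom.inl K K))
    let L2 : K →+ K := c.comp (ψ.toAddMonoidHom.comp (AddMonoidHom.inr K K))
    have hL : ∀ z w, c (ψ (z, w)) = L1 z + L2 w := by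
      intro z w
      have : (z, w) = (z, 0) + (0, w) := by simp
      rw [this, map_add, map_add]; rfl
    obtain ⟨t, ht⟩ := lin_exists hK L1
    have hyv : ∀ y v : K, L1 (β * Ph (0 : ZMod m) y * Ph κ v) + L1 (β * Ph κ y * Ph (0 : ZMod m) v) = 0 := by
      intro y v
      have h1 := hψ' _ (hH (0, y) (0, v))
      have h3 := congrArg c h1
      rw [QB_TF, hL, map_zero] at h3
      simp only [map_zero, mul_zero, zero_mul, add_zero, zero_add] at h3
      rw [← map_add, ← h3, Ph_zero, Ph_zero]
      congr 1
      ring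
    have hR := (BRep.diag hK ht β 0 κ).add (BRep.diag hK ht β κ 0)
    have hZ : BRep (fun _ _ : K => (0 : K)) (fun _ _ : ZMod m => (0 : K)) := by
      intro x u; simp
    have ht0 : ∀ i, t i = 0 := by
      intro i
      have h1 := BRep.unique hK hR hZ hyv i (i + κ)
      simp only [sub_zero, add_sub_cancel_right, if_true] at h1
      rw [if_neg (by intro hh; apply h2κ; linear_combination -hh), add_zero] at h1
      rcases mul_eq_zero.mp h1 with h | h
      · exact h
      · rw [Ph_eq_zero] at h; exact absurd h hβ
    have hL1 : ∀ z, L1 z = 0 := by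
      intro z; rw [ht]; simp [ht0]
    have hL2 : ∀ w, L2 w = 0 := by
      intro w
      have h1 := hψ' _ (hH (w, 0) (0, 1))
      have h3 := congrArg c h1
      rw [QB_TF, hL, map_zero, hL1] at h3
      simpa using h3
    apply hψ0
    ext1
    · ext1 z
      apply hc
      change c (ψ (z, 0)) = c 0
      rw [hL, hL1, map_zero, map_zero, add_zero]
    · ext1 z
      apply hc
      change c (ψ (0, z)) = c 0
      rw [hL, hL2, map_zero, map_zero, add_zero]

end TanForm


section Steps

variable {K : Type*} [Field K] [CharP K 2] {m : ℕ}

lemma alg_one {a1 a2 b b' c1 c2 d d' : K} (x1 : 0 = a1 * d + c1 * b) (x2 : 0 = a2 * d + c2 * b) :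
    (a1 * c2 + c1 * a2) * (b * d' + d * b') = 0 := by
  have h2 : (2 : K) = 0 := CharTwo.two_eq_zero
  grind

lemma alg_two {a a' b b' c c' d d' : K} (x3 : 0 = a * d' + c * b') (x4 : 0 = a' * d + c' * b)
    (y1 : 0 = a * c' + c * a') : (a * d + c * b) * (a' * d' + c' * b') = 0 := by
  have h2 : (2 : K) = 0 := CharTwo.two_eq_zero
  grind

lemma alg_three {a a' b c c' d : K} (x3 : 0 = a' * d + c' * b) (y1 : 0 = a' * c + c' * a) :
    a' * (a * d + c * b) = 0 ∧ c' * (a * d + c * b) = 0 := by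
  have h2 : (2 : K) = 0 := CharTwo.two_eq_zero
  constructor <;> grind

lemma alg_four {a b b' c d d' : K} (x3 : 0 = a * d' + c * b') (y1 : 0 = b * d' + d * b') :
    b' * (a * d + c * b) = 0 ∧ d' * (a * d + c * b) = 0 := by
  have h2 : (2 : K) = 0 := CharTwo.two_eq_zero
  constructor <;> grind

/-- all needed hypotheses say: `M` and `N` come from `ccz_EA` -/
lemma step_one [NeZero m] (hK : Nat.card K = 2 ^ m) {κ l : ZMod m} {α β α' β' : K} (hβ : β ≠ 0)
    (h1κ : κ ≠ 0) (h2κ : 2 * κ ≠ 0) (h3κ : 3 * κ ≠ 0)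
    {M N : K × K →+ K × K} (hN : Function.Injective N)
    (h : ∀ p q, N (QB (TF κ α β) p q) = QB (TF l α' β') (M p) (M q)) :
    (∀ z, (N (z, 0)).2 = 0) ∧ ∃ (ρ : ZMod m) (a b c d : K), a * d + b * c ≠ 0 ∧
      ∀ x y, M (x, y) = (a * Ph ρ x + b * Ph ρ y, c * Ph ρ x + d * Ph ρ y) := by
  have h2 : (2 : K) = 0 := CharTwo.two_eq_zero
  have hpos : 0 < Nat.card K := by rw [hK]; positivity
  have hfinK : Finite K := Nat.finite_of_card_ne_zero (by omega)
  let fs : K × K →+ K := AddMonoidHom.fst K K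
  let sn : K × K →+ K := AddMonoidHom.snd K K
  obtain ⟨a, ha⟩ := lin_exists hK (fs.comp (M.comp (AddMonoidHom.inl K K)))
  obtain ⟨b, hb⟩ := lin_exists hK (fs.comp (M.comp (AddMonoidHom.inr K K)))
  obtain ⟨c, hc⟩ := lin_exists hK (sn.comp (M.comp (AddMonoidHom.inl K K)))
  obtain ⟨d, hd⟩ := lin_exists hK (sn.comp (M.comp (AddMonoidHom.inr K K)))
  obtain ⟨n, hn⟩ := lin_exists hK (sn.comp (N.comp (AddMonoidHom.inl K K)))
  obtain ⟨n', hn'⟩ := lin_exists hK (sn.comp (N.comp (AddMonoidHom.inr K K)))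
  set A := (fs.comp (M.comp (AddMonoidHom.inl K K)))
  set B := (fs.comp (M.comp (AddMonoidHom.inr K K)))
  set C := (sn.comp (M.comp (AddMonoidHom.inl K K)))
  set D := (sn.comp (M.comp (AddMonoidHom.inr K K)))
  set P := (sn.comp (N.comp (AddMonoidHom.inl K K)))
  set P' := (sn.comp (N.comp (AddMonoidHom.inr K K)))
  have hM1 : ∀ x, M (x, 0) = (A x, C x) := fun x => rfl
  have hM2 : ∀ x, M (0, x) = (B x, D x) := fun x => rfl
  have hNs : ∀ z w, (N (z, w)).2 = P z + P' w := by
    intro z w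
    have : (z, w) = (z, 0) + (0, w) := by simp
    rw [this, map_add]; rfl
  have exu : ∀ x u, P (1 * Ph (3 * κ) x * Ph (2 * κ) u) + P (1 * Ph (2 * κ) x * Ph (3 * κ) u) =
      A x * C u + C x * A u := by
    intro x u
    have := congrArg Prod.snd (h (x, 0) (u, 0))
    rw [QB_TF, hM1, hM1, QB_TF, hNs] at this
    simp only [map_zero, mul_zero, zero_mul, add_zero] at this
    rw [← map_add, one_mul, one_mul, this]
  have eyv : ∀ y v, P (β * Ph (0 : ZMod m) y * Ph κ v) + P (β * Ph κ y * Ph (0 : ZMod m) v) =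
      B y * D v + D y * B v := by
    intro y v
    have := congrArg Prod.snd (h (0, y) (0, v))
    rw [QB_TF, hM2, hM2, QB_TF, hNs] at this
    simp only [map_zero, mul_zero, zero_mul, add_zero, zero_add] at this
    rw [← map_add, ← this, Ph_zero, Ph_zero]
    congr 1
    ring
  have exv : ∀ x v, P (α * Ph (2 * κ) x * Ph κ v) + P' (1 * Ph (0 : ZMod m) x * Ph (0 : ZMod m) v) =
      A x * D v + C x * B v := by
    intro x v
    have := congrArg Prod.snd (h (x, 0) (0, v))
    rw [QB_TF, hM1, hM2, QB_TF, hNs] at this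
    simp only [map_zero, mul_zero, zero_mul, add_zero, zero_add] at this
    rw [← this, Ph_zero, Ph_zero, one_mul, mul_assoc]
  have rxu := BRep.unique hK ((BRep.diag hK hn 1 (3 * κ) (2 * κ)).add (BRep.diag hK hn 1 (2 * κ) (3 * κ)))
    ((BRep.prod ha hc).add (BRep.prod hc ha)) exu
  have ryv := BRep.unique hK ((BRep.diag hK hn β 0 κ).add (BRep.diag hK hn β κ 0))
    ((BRep.prod hb hd).add (BRep.prod hd hb)) eyv
  have rxv := BRep.unique hK ((BRep.diag hK hn α (2 * κ) κ).add (BRep.diag hK hn' 1 0 0))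
    ((BRep.prod ha hd).add (BRep.prod hc hb)) exv
  simp only [map_one, mul_one, sub_zero] at rxu ryv rxv
  have hn0 : ∀ i, n i = 0 := by
    intro i
    have t1 := rxu (i + 2 * κ) (i + 3 * κ)
    have t2 := ryv i (i + κ)
    have x1 := rxv (i + 2 * κ) i
    have x2 := rxv (i + 3 * κ) i
    have x3 := rxv (i + 3 * κ) (i + κ)
    rw [if_neg (by intro hh; apply h2κ; linear_combination -hh), zero_add,
      if_pos (by ring), show i + 2 * κ - 2 * κ = i by ring] at t1
    rw [if_pos (by ring), if_neg (by intro hh; apply h2κ; linear_combination -hh), add_zero] at t2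
    rw [if_neg (by intro hh; apply h1κ; linear_combination hh),
      if_neg (by intro hh; apply h2κ; linear_combination hh), add_zero] at x1
    rw [if_neg (by intro hh; apply h2κ; linear_combination hh),
      if_neg (by intro hh; apply h3κ; linear_combination hh), add_zero] at x2
    have key : n i * (n i * Ph i β) = 0 := by
      rw [t2, t1]
      exact alg_one x1 x2
    rcases mul_eq_zero.mp key with h | h
    · exact h
    · rcases mul_eq_zero.mp h with h | h
      · exact h
      · rw [Ph_eq_zero] at h; exact absurd h hβ
  have hP0 : ∀ z, P z = 0 := by
    intro z; rw [hn]; simp [hn0]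
  refine ⟨hP0, ?_⟩
  simp only [hn0, zero_mul, ite_self, add_zero, zero_add] at rxu ryv rxv
  obtain ⟨ρ, hρ⟩ : ∃ ρ, n' ρ ≠ 0 := by
    by_contra hcon
    push Not at hcon
    have hsurj := Finite.injective_iff_surjective.mp hN
    obtain ⟨⟨z, w⟩, hzw⟩ := hsurj (0, 1)
    have h1 := congrArg Prod.snd hzw
    rw [hNs, hP0, hn'] at h1
    simp [hcon] at h1
  have hdet : a ρ * d ρ + c ρ * b ρ ≠ 0 := by
    have := rxv ρ ρ
    rw [if_pos rfl] at this
    rwa [← this]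
  have hs0 : ∀ s, s ≠ ρ → n' s = 0 := by
    intro s hs
    have x1 := rxv ρ ρ
    have x2 := rxv s s
    have x3 := rxv ρ s
    have x4 := rxv s ρ
    rw [if_pos rfl] at x1 x2
    rw [if_neg hs.symm] at x3
    rw [if_neg hs] at x4
    have y1 := rxu ρ s
    have : n' ρ * n' s = 0 := by
      rw [x1, x2]
      exact alg_two x3 x4 y1
    exact (mul_eq_zero.mp this).resolve_left hρ
  have hac : ∀ s, s ≠ ρ → a s = 0 ∧ c s = 0 := by
    intro s hs
    have x3 := rxv s ρ
    rw [if_neg hs] at x3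
    have y1 := rxu s ρ
    constructor
    · have : a s * (a ρ * d ρ + c ρ * b ρ) = 0 := by
        exact (alg_three x3 y1).1
      exact (mul_eq_zero.mp this).resolve_right hdet
    · have : c s * (a ρ * d ρ + c ρ * b ρ) = 0 := by
        exact (alg_three x3 y1).2
      exact (mul_eq_zero.mp this).resolve_right hdet
  have hbd : ∀ s, s ≠ ρ → b s = 0 ∧ d s = 0 := by
    intro s hs
    have x3 := rxv ρ s
    rw [if_neg hs.symm] at x3
    have y1 := ryv ρ s
    constructor
    · have : b s * (a ρ * d ρ + c ρ * b ρ) = 0 := by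
        exact (alg_four x3 y1).1
      exact (mul_eq_zero.mp this).resolve_right hdet
    · have : d s * (a ρ * d ρ + c ρ * b ρ) = 0 := by
        exact (alg_four x3 y1).2
      exact (mul_eq_zero.mp this).resolve_right hdet
  have single : ∀ (t : ZMod m → K) (_ : ∀ s, s ≠ ρ → t s = 0) x, ∑ i, t i * Ph i x = t ρ * Ph ρ x := by
    intro t ht x
    rw [Finset.sum_eq_single ρ]
    · intro s _ hs; rw [ht s hs, zero_mul]
    · simp
  refine ⟨ρ, a ρ, b ρ, c ρ, d ρ, by rwa [mul_comm (b ρ)], fun x y => ?_⟩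
  have : (x, y) = (x, 0) + (0, y) := by simp
  rw [this, map_add, hM1, hM2, ha, hb, hc, hd, single a (fun s hs => (hac s hs).1),
    single b (fun s hs => (hbd s hs).1), single c (fun s hs => (hac s hs).2),
    single d (fun s hs => (hbd s hs).2)]
  rfl

end Steps


section StepTwo

variable {K : Type*} [Field K] [CharP K 2] {m : ℕ}

/-- coefficients of the polarized first component of `TF` -/
def GBc (l : ZMod m) (α' β' a c b d : K) (r s : ZMod m) : K :=
  (if r = 3 * l ∧ s = 2 * l then Ph (3 * l) a * Ph (2 * l) b else 0) +
  (if r = 2 * l ∧ s = 3 * l then Ph (2 * l) a * Ph (3 * l) b else 0) +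
  (if r = 2 * l ∧ s = l then α' * Ph (2 * l) a * Ph l d else 0) +
  (if r = l ∧ s = 2 * l then α' * Ph (2 * l) b * Ph l c else 0) +
  (if r = 0 ∧ s = l then β' * c * Ph l d else 0) +
  (if r = l ∧ s = 0 then β' * d * Ph l c else 0)

lemma GBc_rep [NeZero m] (l : ZMod m) (α' β' a c b d : K) :
    BRep (fun x u => (QB (TF l α' β') (a * x, c * x) (b * u, d * u)).1) (GBc l α' β' a c b d) := by
  have h := (((((BRep.mono (Ph (3 * l) a * Ph (2 * l) b) (3 * l) (2 * l)).add
    (BRep.mono (Ph (2 * l) a * Ph (3 * l) b) (2 * l) (3 * l))).add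
    (BRep.mono (α' * Ph (2 * l) a * Ph l d) (2 * l) l)).add
    (BRep.mono (α' * Ph (2 * l) b * Ph l c) l (2 * l))).add
    (BRep.mono (β' * c * Ph l d) 0 l)).add (BRep.mono (β' * d * Ph l c) l 0)
  intro x u
  refine Eq.trans ?_ (h x u)
  beta_reduce
  rw [QB_TF]
  simp only [map_mul, Ph_zero]
  ring

lemma step_two [NeZero m] (hK : Nat.card K = 2 ^ m) {κ l : ZMod m} {α β α' β' : K}
    (hβ : β ≠ 0) (hβ' : β' ≠ 0)
    (h1κ : κ ≠ 0) (h2κ : 2 * κ ≠ 0) (h3κ : 3 * κ ≠ 0)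
    {M N : K × K →+ K × K} (hN : Function.Injective N)
    (h : ∀ p q, N (QB (TF κ α β) p q) = QB (TF l α' β') (M p) (M q)) :
    (κ = l ∨ κ = -l) ∧ (κ = l → (α = 0 ∧ α' = 0) ∨
      ∃ (ρ : ZMod m) (r : K), r ≠ 0 ∧ Ph ρ α = α' * Ph κ r ∧ Ph ρ β = β' * r * Ph κ r) := by
  obtain ⟨hz, ρ, a, b, c, d, hdet, hM⟩ := step_one hK hβ h1κ h2κ h3κ hN h
  let fs : K × K →+ K := AddMonoidHom.fst K K
  obtain ⟨n, hn⟩ := lin_exists hK ((fs.comp (N.comp (AddMonoidHom.inl K K))).comp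
    (Ph (-ρ) : K →+* K).toAddMonoidHom)
  obtain ⟨n', hn'⟩ := lin_exists hK ((fs.comp (N.comp (AddMonoidHom.inr K K))).comp
    (Ph (-ρ) : K →+* K).toAddMonoidHom)
  set P := ((fs.comp (N.comp (AddMonoidHom.inl K K))).comp (Ph (-ρ) : K →+* K).toAddMonoidHom)
  set P' := ((fs.comp (N.comp (AddMonoidHom.inr K K))).comp (Ph (-ρ) : K →+* K).toAddMonoidHom)
  have hP : ∀ z, P z = (N (Ph (-ρ) z, 0)).1 := fun z => rfl
  have hP' : ∀ z, P' z = (N (0, Ph (-ρ) z)).1 := fun z => rfl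
  have hNs : ∀ z w, (N (Ph (-ρ) z, Ph (-ρ) w)).1 = P z + P' w := by
    intro z w
    have : (Ph (-ρ) z, Ph (-ρ) w) = (Ph (-ρ) z, 0) + (0, Ph (-ρ) w) := by simp
    rw [this, map_add]; rfl
  have hinvρ : ∀ z : K, Ph (-ρ) (Ph ρ z) = z := by
    intro z; rw [← Ph_add hK, neg_add_cancel, Ph_zero]
  have hcomm : ∀ (i : ZMod m) (z : K), Ph i (Ph (-ρ) z) = Ph (-ρ) (Ph i z) := by
    intro i z; rw [← Ph_add hK, ← Ph_add hK, add_comm]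
  have hM1 : ∀ x, M (Ph (-ρ) x, 0) = (a * x, c * x) := by
    intro x; rw [hM, Ph_neg_cancel hK]; simp
  have hM2 : ∀ x, M (0, Ph (-ρ) x) = (b * x, d * x) := by
    intro x; rw [hM, Ph_neg_cancel hK]; simp
  have exu : ∀ x u, P (1 * Ph (3 * κ) x * Ph (2 * κ) u) + P (1 * Ph (2 * κ) x * Ph (3 * κ) u) =
      (QB (TF l α' β') (a * x, c * x) (a * u, c * u)).1 := by
    intro x u
    rw [← hM1, ← hM1, ← h, QB_TF, ← map_add, hP]
    congr 2
    ext
    · simp only [map_zero, mul_zero, zero_mul, add_zero, map_mul, map_add, hcomm, map_one, one_mul]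
    · simp
  have eyv : ∀ y v, P (Ph ρ β * Ph (0 : ZMod m) y * Ph κ v) + P (Ph ρ β * Ph κ y * Ph (0 : ZMod m) v) =
      (QB (TF l α' β') (b * y, d * y) (b * v, d * v)).1 := by
    intro y v
    rw [← hM2, ← hM2, ← h, QB_TF, ← map_add, hP]
    congr 2
    ext
    · simp only [map_zero, mul_zero, zero_mul, add_zero, map_mul, map_add, hcomm, hinvρ, Ph_zero,
        zero_add]
      ring
    · simp
  have exv : ∀ x v, P (Ph ρ α * Ph (2 * κ) x * Ph κ v) + P' (1 * Ph (0 : ZMod m) x * Ph (0 : ZMod m) v) =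
      (QB (TF l α' β') (a * x, c * x) (b * v, d * v)).1 := by
    intro x v
    rw [← hM1, ← hM2, ← h, QB_TF, ← hNs]
    congr 2
    ext
    · simp only [map_zero, mul_zero, zero_mul, add_zero, map_mul, map_add, hcomm, hinvρ, Ph_zero,
        zero_add]
      ring
    · simp [Ph_zero]
  have rxu := BRep.unique hK ((BRep.diag hK hn 1 (3 * κ) (2 * κ)).add (BRep.diag hK hn 1 (2 * κ) (3 * κ)))
    (GBc_rep l α' β' a c a c) exu
  have ryv := BRep.unique hK ((BRep.diag hK hn (Ph ρ β) 0 κ).add (BRep.diag hK hn (Ph ρ β) κ 0))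
    (GBc_rep l α' β' b d b d) eyv
  have rxv := BRep.unique hK ((BRep.diag hK hn (Ph ρ α) (2 * κ) κ).add (BRep.diag hK hn' 1 0 0))
    (GBc_rep l α' β' a c b d) exv
  simp only [map_one, mul_one, sub_zero] at rxu ryv rxv
  constructor
  · by_contra hcon
    push Not at hcon
    obtain ⟨hne1, hne2⟩ := hcon
    have hn0 : ∀ i, n i = 0 := by
      intro i
      have t1 := rxu (i + 2 * κ) (i + 3 * κ)
      rw [if_neg (by intro hh; apply h2κ; linear_combination -hh), zero_add,
        if_pos (by ring), show i + 2 * κ - 2 * κ = i by ring] at t1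
      rw [t1]
      unfold GBc
      rw [if_neg (by rintro ⟨e1, e2⟩; apply hne2; linear_combination e2 - e1),
        if_neg (by rintro ⟨e1, e2⟩; apply hne1; linear_combination e2 - e1),
        if_neg (by rintro ⟨e1, e2⟩; apply hne2; linear_combination e2 - e1),
        if_neg (by rintro ⟨e1, e2⟩; apply hne1; linear_combination e2 - e1),
        if_neg (by rintro ⟨e1, e2⟩; apply hne1; linear_combination e2 - e1),
        if_neg (by rintro ⟨e1, e2⟩; apply hne2; linear_combination e2 - e1)]
      simp
    have h1 : N (1, 0) = 0 := by
      ext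
      · have : P 1 = 0 := by rw [hn]; simp [hn0]
        rw [hP, map_one] at this
        exact this
      · exact hz 1
    have h3 := hN (h1.trans (map_zero N).symm)
    have := congrArg Prod.fst h3
    simp at this
  · intro hkl
    subst hkl
    have n21 : ¬ (2 * κ = κ) := by intro hh; apply h1κ; linear_combination hh
    have n12 : ¬ (κ = 2 * κ) := fun hh => n21 hh.symm
    have n31 : ¬ (3 * κ = κ) := by intro hh; apply h2κ; linear_combination hh
    have n13 : ¬ (κ = 3 * κ) := fun hh => n31 hh.symm
    have n32 : ¬ (3 * κ = 2 * κ) := by intro hh; apply h1κ; linear_combination hh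
    have n23 : ¬ (2 * κ = 3 * κ) := fun hh => n32 hh.symm
    have n10 := h1κ
    have n20 := h2κ
    have n30 := h3κ
    have n01 := h1κ.symm
    have n02 := h2κ.symm
    have n03 := h3κ.symm
    have nm : ¬ (-κ = κ) := by intro hh; apply h2κ; linear_combination -hh
    have hab : a * b = 0 := by
      have t := rxv (2 * κ) (3 * κ)
      rw [if_neg (by intro hh; apply h2κ; linear_combination -hh), if_neg n23] at t
      simp only [GBc, n23, n32, n21, n12, n31, n13, n10, n20, n30, n01, n02, n03, if_false, and_true,
        true_and, and_false, false_and, if_true, add_zero, zero_add] at t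
      rcases mul_eq_zero.mp t.symm with h | h <;> rw [Ph_eq_zero] at h <;> simp [h]
    have hcd : c * d = 0 := by
      have t := rxv 0 κ
      rw [if_neg (by intro hh; apply h2κ; linear_combination -hh), if_neg n01] at t
      simp only [GBc, n23, n32, n21, n12, n31, n13, n10, n20, n30, n01, n02, n03, if_false, and_true,
        true_and, and_false, false_and, if_true, add_zero, zero_add] at t
      rcases mul_eq_zero.mp t.symm with h | h
      · rcases mul_eq_zero.mp h with h | h
        · exact absurd h hβ'
        · simp [h]
      · rw [Ph_eq_zero] at h; simp [h]
    have habc : α' * b * c = 0 := by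
      have t := rxv κ (2 * κ)
      rw [if_neg (by intro hh; apply h2κ; linear_combination -hh), if_neg n12] at t
      simp only [GBc, n23, n32, n21, n12, n31, n13, n10, n20, n30, n01, n02, n03, if_false, and_true,
        true_and, and_false, false_and, if_true, add_zero, zero_add] at t
      rcases mul_eq_zero.mp t.symm with h | h
      · rcases mul_eq_zero.mp h with h | h
        · simp [h]
        · rw [Ph_eq_zero] at h; simp [h]
      · rw [Ph_eq_zero] at h; simp [h]
    by_cases ha : a = 0
    · left
      subst ha
      have hb : b ≠ 0 := by rintro rfl; simp at hdet
      have hc : c ≠ 0 := by rintro rfl; simp at hdet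
      have hd : d = 0 := (mul_eq_zero.mp hcd).resolve_left hc
      have hα' : α' = 0 := by simpa [hb, hc] using habc
      refine ⟨?_, hα'⟩
      subst hd hα'
      have t1 := rxu 0 κ
      rw [if_neg (by intro hh; apply h2κ; linear_combination -hh), if_pos (by ring)] at t1
      simp only [GBc, n23, n32, n21, n12, n31, n13, n10, n20, n30, n01, n02, n03, if_false, and_true,
        true_and, and_false, false_and, if_true, add_zero, zero_add] at t1
      have hn2 : n (0 - 2 * κ) ≠ 0 := by
        rw [t1]
        refine mul_ne_zero (mul_ne_zero hβ' hc) ?_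
        rwa [Ne, Ph_eq_zero]
      have t2 := rxv 0 (-κ)
      rw [if_pos (by ring), if_neg (by intro hh; apply h1κ; linear_combination hh)] at t2
      simp [GBc] at t2
      rcases t2 with h | h
      · exact absurd h (by simpa using hn2)
      · exact h
    · right
      have hb : b = 0 := (mul_eq_zero.mp hab).resolve_left ha
      subst hb
      have hd : d ≠ 0 := by rintro rfl; simp at hdet
      have hc : c = 0 := (mul_eq_zero.mp hcd).resolve_right hd
      subst hc
      have t1 := rxu (2 * κ) (3 * κ)
      rw [if_neg (by intro hh; apply h2κ; linear_combination -hh), if_pos (by ring), sub_self] at t1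
      simp only [GBc, n23, n32, n21, n12, n31, n13, n10, n20, n30, n01, n02, n03, if_false, and_true,
        true_and, and_false, false_and, if_true, add_zero, zero_add] at t1
      have t2 := ryv 0 κ
      rw [if_pos (by ring), if_neg (by intro hh; apply h2κ; linear_combination -hh), Ph_zero] at t2
      simp only [GBc, n23, n32, n21, n12, n31, n13, n10, n20, n30, n01, n02, n03, if_false, and_true,
        true_and, and_false, false_and, if_true, add_zero, zero_add] at t2
      have t3 := rxv (2 * κ) κ
      rw [if_pos (by ring), if_neg n21, sub_self, Ph_zero] at t3
      simp only [GBc, n23, n32, n21, n12, n31, n13, n10, n20, n30, n01, n02, n03, if_false, and_true,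
        true_and, and_false, false_and, if_true, add_zero, zero_add] at t3
      have ha2 : Ph (2 * κ) a ≠ 0 := by rwa [Ne, Ph_eq_zero]
      have ha3 : Ph (3 * κ) a ≠ 0 := by rwa [Ne, Ph_eq_zero]
      have e3 : Ph κ (Ph (2 * κ) a) = Ph (3 * κ) a := by
        rw [← Ph_add hK]; congr 1; ring
      refine ⟨ρ, d / Ph (2 * κ) a, div_ne_zero hd ha2, ?_, ?_⟩
      · rw [map_div₀, e3]
        rw [t1] at t3
        field_simp
        apply mul_left_cancel₀ ha2
        linear_combination t3
      · rw [map_div₀, e3]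
        rw [t1] at t2
        field_simp
        linear_combination t2

end StepTwo


section Ineq

variable {K : Type*} [Field K] [CharP K 2] {m : ℕ}

lemma coprime_unit [NeZero m] {k : ℕ} (h : Nat.gcd k m = 1) : IsUnit (k : ZMod m) :=
  (ZMod.isUnit_iff_coprime k m).2 h

lemma Ph_nsmul [NeZero m] (hK : Nat.card K = 2 ^ m) (i : ZMod m) {x : K} (h : Ph i x = x) (j : ℕ) :
    Ph ((j : ZMod m) * i) x = x := by
  induction j with
  | zero => simp [Ph_zero]
  | succ j ih => rw [Nat.cast_succ, add_mul, one_mul, Ph_add hK, h, ih]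

lemma Ph_one_apply [NeZero m] (hK : Nat.card K = 2 ^ m) (x : K) : Ph (1 : ZMod m) x = x ^ 2 := by
  have := Ph_natCast (m := m) hK 1 x
  simpa using this

lemma Ph_fix [NeZero m] (hK : Nat.card K = 2 ^ m) {k : ℕ} (hk : Nat.gcd k m = 1) (x : K)
    (h : Ph (k : ZMod m) x = x) : x = 0 ∨ x = 1 := by
  obtain ⟨u, hu⟩ := coprime_unit hk
  have h1 := Ph_nsmul hK _ h ((↑u⁻¹ : ZMod m)).val
  rw [ZMod.natCast_zmod_val, ← hu, Units.inv_mul, Ph_one_apply hK] at h1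
  have : x * (x - 1) = 0 := by linear_combination h1
  rcases mul_eq_zero.mp this with h | h
  · left; exact h
  · right; exact sub_eq_zero.mp h

lemma nat_mul_unit_ne [NeZero m] {k : ℕ} (hk : Nat.gcd k m = 1) (j : ℕ) (hj : 0 < j) (hjm : j < m) :
    (j : ZMod m) * (k : ZMod m) ≠ 0 := by
  intro h
  have := (coprime_unit hk).mul_left_eq_zero.mp h
  rw [ZMod.natCast_eq_zero_iff] at this
  exact absurd (Nat.le_of_dvd hj this) (by omega)

lemma root_conv (hK : Nat.card K = 2 ^ m) {k : ℕ} {α β : K}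
    (h : ∀ x : K, x ^ (2 ^ k + 1) + α * x + β ≠ 0) :
    ∀ z : K, Ph (k : ZMod m) z * z + α * z + β ≠ 0 := by
  intro z hz
  apply h z
  rw [Ph_natCast hK] at hz
  rw [pow_succ]; exact hz

lemma tan_inequiv [Module (ZMod 2) (K × K)] [Finite K] (hm : 4 ≤ m) (hK : Nat.card K = 2 ^ m) {k l : ℕ} {α β α' β' : K}
    (hk : Nat.gcd k m = 1) (hl : Nat.gcd l m = 1) (hβ : β ≠ 0) (hβ' : β' ≠ 0)
    (hr : ∀ x : K, x ^ (2 ^ k + 1) + α * x + β ≠ 0)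
    (hr' : ∀ x : K, x ^ (2 ^ l + 1) + α' * x + β' ≠ 0)
    (h : CCZEquivalent (taniguchi k α β) (taniguchi l α' β')) :
    ((k : ZMod m) = l ∨ (k : ZMod m) = -l) ∧ ((k : ZMod m) = l → (α = 0 ∧ α' = 0) ∨
      ∃ (ρ : ℕ) (r : K), ρ < m ∧ r ≠ 0 ∧ α ^ 2 ^ ρ = α' * r ^ 2 ^ k ∧ β ^ 2 ^ ρ = β' * r * r ^ 2 ^ k) := by
  haveI : NeZero m := ⟨by omega⟩
  rw [tan_eq_TF hK, tan_eq_TF hK] at h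
  have e1 : (k : ZMod m) ≠ 0 := by simpa using nat_mul_unit_ne hk 1 (by omega) (by omega)
  have e2 : 2 * (k : ZMod m) ≠ 0 := by simpa using nat_mul_unit_ne hk 2 (by omega) (by omega)
  have e2' : 2 * (l : ZMod m) ≠ 0 := by simpa using nat_mul_unit_ne hl 2 (by omega) (by omega)
  have e3 : 3 * (k : ZMod m) ≠ 0 := by simpa using nat_mul_unit_ne hk 3 (by omega) (by omega)
  have hc : 16 ≤ Nat.card (K × K) := by
    rw [Nat.card_prod, hK, ← pow_add]
    exact le_trans (by norm_num : 16 ≤ 2 ^ 4) (Nat.pow_le_pow_right (by norm_num) (by omega))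
  obtain ⟨M, N, -, hN, hMN⟩ := ccz_EA hc (TF_quad hK hβ (root_conv hK hr) (Ph_fix hK hk) e2)
    (TF_quad hK hβ' (root_conv hK hr') (Ph_fix hK hl) e2') h
  obtain ⟨h1, h2⟩ := step_two hK hβ hβ' e1 e2 e3 hN hMN
  refine ⟨h1, fun hkl => ?_⟩
  rcases h2 hkl with h | ⟨ρ, r, hr0, ha, hb⟩
  · exact Or.inl h
  · right
    rw [Ph_apply, Ph_natCast hK] at ha hb
    exact ⟨ρ.val, r, ZMod.val_lt ρ, hr0, ha, hb⟩

end Ineq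


section CCZrel

variable {V : Type*} [AddCommGroup V] [Module (ZMod 2) V]

lemma ccz_refl (f : V → V) : CCZEquivalent f f :=
  ⟨id, 0, ⟨fun _ _ => rfl, fun _ _ => rfl⟩, Function.bijective_id, by simp⟩

lemma ccz_symm {f g : V → V} (h : CCZEquivalent f g) : CCZEquivalent g f := by
  obtain ⟨A, c, hA, hb, h⟩ := h
  let L : (V × V) ≃ₗ[ZMod 2] (V × V) := LinearEquiv.ofBijective (hA.mk' A) hb
  refine ⟨L.symm, -L.symm c, ⟨map_add L.symm, map_smul L.symm⟩, L.symm.bijective, ?_⟩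
  rw [← h, Set.image_image]
  have : ∀ x, L.symm (A x + c) + -L.symm c = x := by
    intro x
    rw [map_add, add_neg_cancel_right]
    exact L.symm_apply_apply x
  simp only [this, Set.image_id']

lemma ccz_trans {f g h : V → V} (h1 : CCZEquivalent f g) (h2 : CCZEquivalent g h) :
    CCZEquivalent f h := by
  obtain ⟨A, c, hA, hb, h1⟩ := h1
  obtain ⟨B, d, hB, hbB, h2⟩ := h2
  refine ⟨B ∘ A, B c + d, ⟨fun x y => by simp [hA.map_add, hB.map_add],
    fun x y => by simp [hA.map_smul, hB.map_smul]⟩, hbB.comp hb, ?_⟩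
  rw [← h2, ← h1, Set.image_image]
  congr 1
  funext p
  simp only [Function.comp, hB.map_add, add_assoc]

lemma ccz_of_lin {f g : V → V} (M N : V →+ V) (hM : Function.Bijective M)
    (hN : Function.Bijective N) (h : ∀ x, N (f x) = g (M x)) : CCZEquivalent f g := by
  refine ⟨fun p => (M p.1, N p.2), 0, ⟨fun x y => by simp, fun c x => ?_⟩, ?_, ?_⟩
  · ext
    · exact ZMod.map_smul M c x.1
    · exact ZMod.map_smul N c x.2
  · constructor
    · intro p q hpq
      simp only [Prod.mk.injEq] at hpq
      exact Prod.ext (hM.1 hpq.1) (hN.1 hpq.2)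
    · intro p
      obtain ⟨a, ha⟩ := hM.2 p.1
      obtain ⟨b, hb⟩ := hN.2 p.2
      exact ⟨(a, b), by simp [ha, hb]⟩
  · ext p
    simp only [Set.mem_image, Set.mem_setOf_eq, add_zero]
    constructor
    · rintro ⟨q, hq, rfl⟩
      simp [hq, h]
    · intro hp
      obtain ⟨a, ha⟩ := hM.2 p.1
      refine ⟨(a, f a), rfl, ?_⟩
      ext
      · exact ha
      · simp only [h, ha, hp]

end CCZrel

section Suff

variable {K : Type*} [Field K] [CharP K 2] [Module (ZMod 2) (K × K)] [Finite K] {m : ℕ}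

lemma ccz_of_inj {f g : K × K → K × K} (M N : K × K →+ K × K) (hM : ∀ p, M p = 0 → p = 0)
    (hN : ∀ p, N p = 0 → p = 0) (h : ∀ x, N (f x) = g (M x)) : CCZEquivalent f g :=
  ccz_of_lin M N (Finite.injective_iff_bijective.mp ((injective_iff_map_eq_zero M).2 hM))
    (Finite.injective_iff_bijective.mp ((injective_iff_map_eq_zero N).2 hN)) h

/-- coordinatewise additive maps -/
def dg (A B : K →+ K) : K × K →+ K × K := AddMonoidHom.prodMap A B

lemma dg_apply (A B : K →+ K) (p : K × K) : dg A B p = (A p.1, B p.2) := rfl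

lemma dg_inj (A B : K →+ K) (hA : ∀ x, A x = 0 → x = 0) (hB : ∀ x, B x = 0 → x = 0) (p : K × K)
    (h : dg A B p = 0) : p = 0 := by
  rw [dg_apply, Prod.mk_eq_zero] at h
  exact Prod.ext (hA _ h.1) (hB _ h.2)

lemma tan_scale [NeZero m] (hK : Nat.card K = 2 ^ m) (k : ℕ) (α β : K) {r : K} (hr : r ≠ 0) :
    CCZEquivalent (taniguchi k (α * r ^ 2 ^ k) (β * r * r ^ 2 ^ k)) (taniguchi k α β) := by
  refine ccz_of_inj (dg (AddMonoidHom.id K) (AddMonoidHom.mulLeft r))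
    (dg (AddMonoidHom.id K) (AddMonoidHom.mulLeft r)) (dg_inj _ _ ?_ ?_) (dg_inj _ _ ?_ ?_) ?_
  · simp
  · simp [hr]
  · simp
  · simp [hr]
  · intro p
    simp only [dg_apply, taniguchi, AddMonoidHom.id_apply, AddMonoidHom.coe_mulLeft]
    ext
    · simp only [mul_pow, pow_succ]; ring
    · simp only; ring

lemma tan_frob [NeZero m] (hK : Nat.card K = 2 ^ m) (k : ℕ) (α β : K) (i : ℕ) :
    CCZEquivalent (taniguchi k α β) (taniguchi k (α ^ 2 ^ i) (β ^ 2 ^ i)) := by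
  let F : K →+* K := iterateFrobenius K 2 i
  have hF : ∀ x, F x = x ^ 2 ^ i := fun x => rfl
  refine ccz_of_inj (dg F.toAddMonoidHom F.toAddMonoidHom)
    (dg F.toAddMonoidHom F.toAddMonoidHom) (dg_inj _ _ ?_ ?_) (dg_inj _ _ ?_ ?_) ?_
  · simp
  · simp
  · simp
  · simp
  · intro p
    simp only [dg_apply, taniguchi, RingHom.toAddMonoidHom_eq_coe, AddMonoidHom.coe_coe, map_add,
      map_mul, map_pow]
    simp only [hF]

lemma tan_swap [NeZero m] (hK : Nat.card K = 2 ^ m) (κ : ZMod m) (α β : K) (hβ : β ≠ 0) :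
    CCZEquivalent (TF κ α β) (TF (-κ) (Ph (-(3 * κ)) (α / β)) (Ph (-(3 * κ)) (1 / β))) := by
  let F : K →+* K := Ph (-(3 * κ))
  let G : K →+ K := (AddMonoidHom.mulLeft (F (1 / β))).comp F.toAddMonoidHom
  have hG : ∀ x, G x = F (1 / β) * F x := fun x => rfl
  refine ccz_of_inj ((AddMonoidHom.inl K K).comp (AddMonoidHom.snd K K) +
      (AddMonoidHom.inr K K).comp (AddMonoidHom.fst K K))
    (dg G (AddMonoidHom.id K)) ?_ (dg_inj _ _ ?_ ?_) ?_
  · intro p hp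
    simp [Prod.ext_iff] at hp
    exact Prod.ext hp.2 hp.1
  · intro x hx
    rw [hG] at hx
    rcases mul_eq_zero.mp hx with h | h
    · rw [map_eq_zero] at h; simp [hβ] at h
    · simpa using h
  · simp
  · intro p
    have hsw : ((AddMonoidHom.inl K K).comp (AddMonoidHom.snd K K) +
      (AddMonoidHom.inr K K).comp (AddMonoidHom.fst K K)) p = (p.2, p.1) := by simp
    rw [hsw]
    simp only [dg_apply, TF, AddMonoidHom.id_apply, hG]
    ext
    · simp only [map_add, map_mul, F, map_div₀, map_one]
      have hb : Ph (-(3 * κ)) β ≠ 0 := by rwa [Ne, Ph_eq_zero]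
      simp only [← Ph_add hK]
      have c1 : -(3 * κ) + 3 * κ = 0 := by ring
      have c2 : -(3 * κ) + 2 * κ = -κ := by ring
      have c3 : -(3 * κ) + κ = 2 * -κ := by ring
      have c4 : 3 * -κ = -(3 * κ) := by ring
      rw [c1, c2, c3, c4, Ph_zero]
      field_simp
      ring
    · simp only; ring

end Suff


section RootStructure

variable {K : Type*} [Field K] [CharP K 2]

/-- parametrization of roots -/
def xs (σ : K →+* K) (s : K) : K := (s + σ s) / (s + σ (σ s))

/-- the map `x ↦ x σ(x) + x` -/
def hh (σ : K →+* K) (x : K) : K := x * σ x + x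

lemma add_eq_zero_two {a b : K} : a + b = 0 ↔ a = b := by
  constructor
  · intro h
    have h2 : (2 : K) = 0 := CharTwo.two_eq_zero
    linear_combination h - b * h2
  · rintro rfl; exact CharTwo.add_self_eq_zero a

lemma exists_ratio [Finite K] (σ : K →+* K) (hfix : ∀ x, σ x = x → x = 0 ∨ x = 1) {v : K}
    (hv : v ≠ 0) : ∃ s : K, s ≠ 0 ∧ σ s = v * s := by
  let φ : Kˣ → Kˣ := fun u => Units.map (σ : K →* K) u / u
  have hinj : Function.Injective φ := by
    intro a b hab
    have h1 : Units.map (σ : K →* K) (a / b) = a / b := by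
      rw [map_div, div_eq_div_iff_mul_eq_mul]
      have := div_eq_div_iff_mul_eq_mul.mp hab
      rw [this, mul_comm]
    have h2 : σ ((a / b : Kˣ) : K) = ((a / b : Kˣ) : K) := congrArg Units.val h1
    rcases hfix _ h2 with h | h
    · exact absurd h (Units.ne_zero _)
    · have : a / b = 1 := Units.ext h
      exact div_eq_one.mp this
  obtain ⟨u, hu⟩ := (Finite.injective_iff_surjective.mp hinj) (Units.mk0 v hv)
  refine ⟨u, u.ne_zero, ?_⟩
  have := congrArg Units.val (div_eq_iff_eq_mul.mp hu)
  simpa using this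

/-- the parameter set relative to `σ` -/
def PS (σ : K →+* K) : Set K := {s | s + σ (σ s) ≠ 0}

lemma PS_facts (σ : K →+* K) {s : K} (hs : s ∈ PS σ) :
    s ≠ 0 ∧ s + 1 ≠ 0 ∧ s + σ s ≠ 0 := by
  have hs' : s + σ (σ s) ≠ 0 := hs
  refine ⟨?_, ?_, ?_⟩
  · rintro rfl; simp at hs'
  · intro h
    rw [add_eq_zero_two] at h
    subst h
    simp [CharTwo.add_self_eq_zero] at hs'
  · intro h
    rw [add_eq_zero_two] at h
    rw [← h, ← h, CharTwo.add_self_eq_zero] at hs'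
    exact hs' rfl

lemma PS_add_one (σ : K →+* K) {s : K} (hs : s ∈ PS σ) : s + 1 ∈ PS σ := by
  have h2 : (2 : K) = 0 := CharTwo.two_eq_zero
  intro h
  apply hs
  simp only [map_add, map_one] at h
  linear_combination h - h2

lemma PS_inv (σ : K →+* K) {s : K} (hs : s ∈ PS σ) : s⁻¹ ∈ PS σ := by
  intro h
  apply hs
  rw [add_eq_zero_two] at h ⊢
  simp only [map_inv₀] at h
  exact inv_injective h

lemma xs_add_one (σ : K →+* K) (s : K) : xs σ (s + 1) = xs σ s := by
  have h2 : (2 : K) = 0 := CharTwo.two_eq_zero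
  unfold xs
  simp only [map_add, map_one]
  congr 1
  · linear_combination h2
  · linear_combination h2

lemma xs_ne_zero (σ : K →+* K) {s : K} (hs : s ∈ PS σ) : xs σ s ≠ 0 :=
  div_ne_zero (PS_facts σ hs).2.2 hs

lemma xs_eq (σ : K →+* K) (hfix : ∀ x, σ x = x → x = 0 ∨ x = 1) {s s' : K} (hs : s ∈ PS σ)
    (hs' : s' ∈ PS σ) : xs σ s = xs σ s' ↔ (s' = s ∨ s' = s + 1) := by
  have h2 : (2 : K) = 0 := CharTwo.two_eq_zero
  constructor
  · intro h
    have hA := (PS_facts σ hs).2.2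
    have hA' := (PS_facts σ hs').2.2
    unfold xs at h
    rw [div_eq_div_iff hs hs'] at h
    have h1 : σ ((s' + σ s') / (s + σ s)) = (s' + σ s') / (s + σ s) := by
      have hσ : σ (s + σ s) ≠ 0 := by rwa [Ne, map_eq_zero]
      rw [map_div₀, div_eq_div_iff hσ hA]
      simp only [map_add]
      linear_combination h + (σ s' * s - σ s * s') * h2
    have h3 : s' + σ s' = s + σ s := by
      rcases hfix _ h1 with h | h
      · exact absurd h (div_ne_zero hA' hA)
      · exact (div_eq_one_iff_eq hA).mp h
    have h4 : σ (s + s') = s + s' := by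
      rw [map_add]; linear_combination -h3 + (σ s' ) * h2 - s * h2
    rcases hfix _ h4 with h | h
    · left; exact (add_eq_zero_two.mp h).symm
    · right; linear_combination h - s * h2
  · rintro (rfl | rfl)
    · rfl
    · exact (xs_add_one σ s).symm

lemma hh_xs (σ : K →+* K) {s : K} (hs : s ∈ PS σ) :
    hh σ (xs σ s) = (s + σ s) * σ (σ (s + σ s)) / ((s + σ (σ s)) * σ (s + σ (σ s))) := by
  have h2 : (2 : K) = 0 := CharTwo.two_eq_zero
  have hd : s + σ (σ s) ≠ 0 := hs
  have hd' : σ (s + σ (σ s)) ≠ 0 := by rwa [Ne, map_eq_zero]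
  unfold hh xs
  rw [map_div₀]
  field_simp
  simp only [map_add]
  linear_combination (s * σ s + σ s ^ 2) * h2

lemma hh_xs_inv (σ : K →+* K) {s : K} (hs : s ∈ PS σ) :
    hh σ (xs σ s⁻¹) = hh σ (xs σ s) := by
  rw [hh_xs σ hs, hh_xs σ (PS_inv σ hs)]
  have h0 := (PS_facts σ hs).1
  have hd : s + σ (σ s) ≠ 0 := hs
  have hdi : s⁻¹ + σ (σ s⁻¹) ≠ 0 := PS_inv σ hs
  have hd' : σ (s + σ (σ s)) ≠ 0 := by rwa [Ne, map_eq_zero]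
  have hdi' : σ (s⁻¹ + σ (σ s⁻¹)) ≠ 0 := by rwa [Ne, map_eq_zero]
  have h1 : σ s ≠ 0 := by rwa [Ne, map_eq_zero]
  have h3 : σ (σ s) ≠ 0 := by rwa [Ne, map_eq_zero]
  have h4 : σ (σ (σ s)) ≠ 0 := by rwa [Ne, map_eq_zero]
  rw [div_eq_div_iff (mul_ne_zero hdi hdi') (mul_ne_zero hd hd')]
  simp only [map_add, map_inv₀]
  field_simp
  ring

lemma xs_inv_ne (σ : K →+* K) {s : K} (hs : s ∈ PS σ) : xs σ s⁻¹ ≠ xs σ s := by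
  have h0 := (PS_facts σ hs).1
  have hA := (PS_facts σ hs).2.2
  have hd : s + σ (σ s) ≠ 0 := hs
  have hdi : s⁻¹ + σ (σ s⁻¹) ≠ 0 := PS_inv σ hs
  have h1 : σ s ≠ 0 := by rwa [Ne, map_eq_zero]
  have h3 : σ (σ s) ≠ 0 := by rwa [Ne, map_eq_zero]
  have e : xs σ s⁻¹ = xs σ s * (σ (σ s) / σ s) := by
    unfold xs
    rw [div_mul_div_comm, div_eq_div_iff hdi (mul_ne_zero hd h1)]
    simp only [map_inv₀]
    field_simp
    ring
  intro h
  rw [e] at h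
  have h5 : σ (σ s) / σ s = 1 := by
    apply mul_left_cancel₀ (xs_ne_zero σ hs); rw [h, mul_one]
  rw [div_eq_one_iff_eq h1] at h5
  apply hA
  rw [add_eq_zero_two]
  exact (σ.injective h5).symm

lemma hh_eq_zero (σ : K →+* K) {x : K} : hh σ x = 0 ↔ x = 0 ∨ x = 1 := by
  unfold hh
  rw [show x * σ x + x = x * (σ x + 1) by ring, mul_eq_zero, add_eq_zero_two]
  constructor
  · rintro (h | h)
    · exact Or.inl h
    · right; apply σ.injective; rw [h, map_one]
  · rintro (h | h)
    · exact Or.inl h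
    · right; rw [h, map_one]

lemma pair_param [Finite K] (σ : K →+* K) (hfix : ∀ x, σ x = x → x = 0 ∨ x = 1) {x y : K}
    (hx : hh σ x ≠ 0) (hxy : x ≠ y) (h : hh σ x = hh σ y) :
    ∃ s ∈ PS σ, x = xs σ s ∧ y = xs σ s⁻¹ := by
  have h2 : (2 : K) = 0 := CharTwo.two_eq_zero
  have hsurj : Function.Surjective σ := Finite.injective_iff_surjective.mp σ.injective
  have hx0 : x ≠ 0 := by rintro rfl; exact hx (by simp [hh])
  have hy0 : y ≠ 0 := by rintro rfl; exact hx (by rw [h]; simp [hh])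
  obtain ⟨v, hv⟩ := hsurj (y / x)
  have hv0 : v ≠ 0 := by rintro rfl; rw [map_zero] at hv; exact (div_ne_zero hy0 hx0) hv.symm
  have hv1 : v ≠ 1 := by
    rintro rfl; rw [map_one] at hv; exact hxy ((div_eq_one_iff_eq hx0).mp hv.symm).symm
  have hyx : y = x * σ v := by rw [hv]; field_simp
  have e : x + 1 = v * (x * σ v + 1) := by
    apply σ.injective
    apply mul_left_cancel₀ hx0
    unfold hh at h
    rw [hyx] at h
    simp only [map_add, map_mul, map_one] at h ⊢
    linear_combination h
  obtain ⟨s, hs0, hs⟩ := exists_ratio σ hfix hv0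
  have hss : σ (σ s) = σ v * v * s := by rw [hs, map_mul, hs]; ring
  have hPS : s ∈ PS σ := by
    intro hc
    rw [hss] at hc
    have h5 : 1 + v * σ v = 0 := by
      apply mul_left_cancel₀ hs0; linear_combination hc
    apply hv1
    linear_combination -e + x * h5 + h2 * (1 - x * v * σ v) - h2
  have hd : s + σ (σ s) ≠ 0 := hPS
  have hxe : x = xs σ s := by
    unfold xs
    rw [eq_div_iff hd, hss, hs]
    linear_combination s * e + h2 * (x * v * σ v * s) - h2 * s
  refine ⟨s, hPS, hxe, ?_⟩
  have hdi : s⁻¹ + σ (σ s⁻¹) ≠ 0 := PS_inv σ hPS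
  unfold xs at hxe ⊢
  rw [eq_div_iff hdi]
  rw [eq_div_iff hd] at hxe
  have h1 : σ s ≠ 0 := by rwa [Ne, map_eq_zero]
  have h3 : σ (σ s) ≠ 0 := by rwa [Ne, map_eq_zero]
  have hvs : σ v = σ (σ s) / σ s := by rw [hss, hs]; field_simp
  rw [hyx, hvs]
  simp only [map_inv₀]
  field_simp
  linear_combination hxe

/-- the anharmonic orbit -/
def An (s s' : K) : Prop := (s' = s ∨ s' = s + 1) ∨ (s' = s⁻¹ ∨ s' = s⁻¹ + 1) ∨
  (s' = (s + 1)⁻¹ ∨ s' = (s + 1)⁻¹ + 1)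

lemma hh_xs_eq [Finite K] (σ : K →+* K) (hfix : ∀ x, σ x = x → x = 0 ∨ x = 1) {s s' : K}
    (hs : s ∈ PS σ) (hs' : s' ∈ PS σ) : hh σ (xs σ s) = hh σ (xs σ s') ↔ An s s' := by
  constructor
  · intro h
    by_cases hx : xs σ s = xs σ s'
    · exact Or.inl ((xs_eq σ hfix hs hs').mp hx)
    · right
      have h0 : hh σ (xs σ s) ≠ 0 := by
        rw [hh_xs σ hs]
        refine div_ne_zero (mul_ne_zero (PS_facts σ hs).2.2 ?_) (mul_ne_zero hs ?_)
        · rw [Ne, map_eq_zero, map_eq_zero]; exact (PS_facts σ hs).2.2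
        · rw [Ne, map_eq_zero]; exact hs
      obtain ⟨t, ht, e1, e2⟩ := pair_param σ hfix h0 hx h
      have e3 := (xs_eq σ hfix (PS_inv σ ht) hs').mp e2.symm
      rcases (xs_eq σ hfix hs ht).mp e1 with rfl | rfl
      · exact Or.inl e3
      · exact Or.inr e3
  · rintro (h | h | h)
    · rw [(xs_eq σ hfix hs hs').mpr h]
    · rw [← (xs_eq σ hfix (PS_inv σ hs) hs').mpr h, hh_xs_inv σ hs]
    · have h1 := PS_add_one σ hs
      rw [← (xs_eq σ hfix (PS_inv σ h1) hs').mpr h, hh_xs_inv σ h1, xs_add_one]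

end RootStructure


section Orbits

variable {K : Type*} [Field K] [CharP K 2] {m : ℕ}

/-- the Frobenius orbit -/
def Orb (m : ℕ) (x : K) : Set K := {γ | ∃ i : ℕ, i < m ∧ γ = x ^ 2 ^ i}

lemma mem_Orb_any [NeZero m] (hK : Nat.card K = 2 ^ m) (x : K) (i : ℕ) : x ^ 2 ^ i ∈ Orb m x :=
  ⟨i % m, Nat.mod_lt _ (NeZero.pos m), (pow_mod hK x i).symm⟩

lemma mem_Orb_self [NeZero m] (x : K) : x ∈ Orb m x := ⟨0, NeZero.pos m, by simp⟩

lemma Orb_pow [NeZero m] (hK : Nat.card K = 2 ^ m) (x : K) (i : ℕ) : Orb m (x ^ 2 ^ i) = Orb m x := by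
  ext γ
  constructor
  · rintro ⟨j, -, rfl⟩
    rw [← pow_mul, ← pow_add]
    exact mem_Orb_any hK x _
  · rintro ⟨j, hj, rfl⟩
    have : x ^ 2 ^ j = (x ^ 2 ^ i) ^ 2 ^ (j + (m - 1) * i) := by
      rw [← pow_mul, ← pow_add, ← pow_add_mul hK x j i]
      congr 2
      have := NeZero.pos m
      obtain ⟨n, rfl⟩ : ∃ n, m = n + 1 := ⟨m - 1, by omega⟩
      simp; ring
    rw [this]
    exact mem_Orb_any hK _ _

lemma Orb_eq_iff [NeZero m] (hK : Nat.card K = 2 ^ m) (x y : K) :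
    Orb m x = Orb m y ↔ ∃ i < m, y = x ^ 2 ^ i := by
  constructor
  · intro h
    have : y ∈ Orb m x := h ▸ mem_Orb_self y
    exact this
  · rintro ⟨i, -, rfl⟩
    exact (Orb_pow hK x i).symm

lemma Orb_eq_iff' [NeZero m] (hK : Nat.card K = 2 ^ m) (x y : K) :
    Orb m x = Orb m y ↔ ∃ i, y = x ^ 2 ^ i := by
  constructor
  · intro h
    obtain ⟨i, -, h⟩ := (Orb_eq_iff hK x y).mp h
    exact ⟨i, h⟩
  · rintro ⟨i, rfl⟩
    exact (Orb_pow hK x i).symm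

/-- number of Frobenius orbits -/
noncomputable def no (m : ℕ) (S : Set K) : ℕ := (Orb m '' S).ncard

/-- Frobenius stable set -/
def FInv (S : Set K) : Prop := ∀ x ∈ S, ∀ i : ℕ, x ^ 2 ^ i ∈ S

lemma no_union [NeZero m] [Finite K] {S T : Set K} (hS : FInv S) (hd : Disjoint S T) :
    no m (S ∪ T) = no m S + no m T := by
  unfold no
  rw [Set.image_union, Set.ncard_union_eq _ (Set.toFinite _) (Set.toFinite _)]
  rw [Set.disjoint_left]
  rintro _ ⟨x, hx, rfl⟩ ⟨y, hy, hxy⟩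
  have hyx : y ∈ Orb m x := hxy ▸ mem_Orb_self y
  obtain ⟨i, -, rfl⟩ := hyx
  exact Set.disjoint_left.mp hd (hS x hx i) hy

/-- images with the same kernel have equal cardinality -/
lemma ncard_same_kernel {A B C : Type*} (S : Set A) (f : A → B) (g : A → C)
    (h : ∀ x ∈ S, ∀ y ∈ S, f x = f y ↔ g x = g y) : (f '' S).ncard = (g '' S).ncard := by
  classical
  have key : ∀ b : (f '' S : Set B), ∃ a, a ∈ S ∧ f a = b := fun b => b.2
  choose c hcS hcf using key
  apply Set.ncard_congr'
  refine Equiv.ofBijective (fun b => ⟨g (c b), c b, hcS b, rfl⟩) ⟨?_, ?_⟩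
  · intro b b' hb
    have hb' : g (c b) = g (c b') := congrArg Subtype.val hb
    rw [← h _ (hcS b) _ (hcS b'), hcf, hcf] at hb'
    exact Subtype.ext hb'
  · rintro ⟨_, x, hx, rfl⟩
    refine ⟨⟨f x, x, hx, rfl⟩, ?_⟩
    apply Subtype.ext
    exact (h _ (hcS _) _ hx).mp (hcf _)

lemma Ph_pow_comm (κ : ZMod m) (x : K) (i : ℕ) : Ph κ (x ^ 2 ^ i) = (Ph κ x) ^ 2 ^ i := map_pow _ _ _

lemma hh_pow (κ : ZMod m) (x : K) (i : ℕ) : hh (Ph κ) (x ^ 2 ^ i) = (hh (Ph κ) x) ^ 2 ^ i := by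
  unfold hh
  rw [add_pow_char_pow, mul_pow, map_pow]

lemma xs_pow (κ : ZMod m) (x : K) (i : ℕ) : xs (Ph κ) (x ^ 2 ^ i) = (xs (Ph κ) x) ^ 2 ^ i := by
  unfold xs
  rw [div_pow, add_pow_char_pow, add_pow_char_pow, map_pow, map_pow]

lemma PS_pow (κ : ZMod m) {x : K} (hx : x ∈ PS (Ph κ)) (i : ℕ) : x ^ 2 ^ i ∈ PS (Ph κ) := by
  intro h
  apply hx
  rw [map_pow, map_pow, ← add_pow_char_pow] at h
  exact pow_eq_zero_iff (by positivity) |>.mp h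

lemma PS_eq [NeZero m] (hK : Nat.card K = 2 ^ m) {k : ℕ} (hk : Nat.gcd k m = 1) :
    PS (Ph (k : ZMod m) : K →+* K) = {s | s ^ 4 ≠ s} := by
  ext s
  simp only [PS, Set.mem_setOf_eq, Ne]
  rw [not_iff_not, add_eq_zero_two, ← Ph_add hK]
  have e2 : s ^ 4 = Ph (2 : ZMod m) s := by
    have := Ph_natCast (m := m) hK 2 s
    rw [Nat.cast_ofNat] at this
    rw [this]; norm_num
  rw [e2]
  constructor
  · intro h
    obtain ⟨u, hu⟩ := coprime_unit hk
    have h1 := Ph_nsmul hK _ h.symm ((↑u⁻¹ : ZMod m)).val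
    rw [ZMod.natCast_zmod_val, ← hu, mul_add, Units.inv_mul, one_add_one_eq_two] at h1
    exact h1
  · intro h
    have h1 := Ph_nsmul hK _ h k
    rw [mul_two] at h1
    exact h1.symm

lemma no_main [NeZero m] [Finite K] (hK : Nat.card K = 2 ^ m) {k : ℕ} (hk : Nat.gcd k m = 1) :
    no m (Set.univ : Set K) + ((fun s => Orb m (xs (Ph (k : ZMod m) : K →+* K) s)) '' {s : K | s ^ 4 ≠ s}).ncard =
    no m {β : K | ∀ x, hh (Ph (k : ZMod m)) x ≠ β} + (no m {0, (1:K)}ᶜ + no m {(0:K)} +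
      ((fun s => Orb m (hh (Ph (k : ZMod m)) (xs (Ph (k : ZMod m) : K →+* K) s))) '' {s : K | s ^ 4 ≠ s}).ncard) := by
  set σ : K →+* K := Ph (k : ZMod m) with hσ
  have hfix : ∀ x, σ x = x → x = 0 ∨ x = 1 := Ph_fix hK hk
  have hPS : PS σ = {s : K | s ^ 4 ≠ s} := PS_eq hK hk
  rw [← hPS]
  set X1 : Set K := {x | hh σ x ≠ 0 ∧ ∀ y, hh σ y = hh σ x → y = x} with hX1
  set X3 : Set K := xs σ '' PS σ with hX3
  have hh0 : ∀ s ∈ PS σ, hh σ (xs σ s) ≠ 0 := by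
    intro s hs
    rw [hh_xs σ hs]
    refine div_ne_zero (mul_ne_zero (PS_facts σ hs).2.2 ?_) (mul_ne_zero hs ?_)
    · rw [Ne, map_eq_zero, map_eq_zero]; exact (PS_facts σ hs).2.2
    · rw [Ne, map_eq_zero]; exact hs
  have hX3' : ∀ x ∈ X3, ∃ y, y ≠ x ∧ hh σ y = hh σ x := by
    rintro _ ⟨s, hs, rfl⟩
    exact ⟨_, xs_inv_ne σ hs, hh_xs_inv σ hs⟩
  have hcases : ∀ x, hh σ x ≠ 0 → x ∈ X1 ∨ x ∈ X3 := by
    intro x hx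
    by_cases h : ∀ y, hh σ y = hh σ x → y = x
    · exact Or.inl ⟨hx, h⟩
    · push Not at h
      obtain ⟨y, hy, hne⟩ := h
      obtain ⟨s, hs, e, -⟩ := pair_param σ hfix hx (Ne.symm hne) hy.symm
      exact Or.inr ⟨s, hs, e.symm⟩
  have hpne : ∀ (x : K) (i : ℕ), x ≠ 0 → x ^ 2 ^ i ≠ 0 := fun x i h => pow_ne_zero _ h
  have iX3 : FInv X3 := by
    rintro _ ⟨s, hs, rfl⟩ i
    exact ⟨_, PS_pow _ hs i, xs_pow _ _ _⟩
  have dX : Disjoint X3 X1 := by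
    rw [Set.disjoint_left]
    intro x h3 h1
    obtain ⟨y, hy, h⟩ := hX3' x h3
    exact hy (h1.2 y h)
  have hX : ({0, (1:K)}ᶜ : Set K) = X3 ∪ X1 := by
    ext x
    simp only [Set.mem_compl_iff, Set.mem_insert_iff, Set.mem_singleton_iff, Set.mem_union]
    rw [← hh_eq_zero σ]
    constructor
    · intro h; exact (hcases x h).symm
    · rintro (⟨s, hs, rfl⟩ | h)
      · exact hh0 s hs
      · exact h.1
  have n1 : no m ({0, (1:K)}ᶜ : Set K) = no m X3 + no m X1 := by
    rw [hX, no_union iX3 dX]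
  have n2 : no m X3 = ((fun s => Orb m (xs σ s)) '' PS σ).ncard := by
    unfold no; rw [hX3, Set.image_image]
  have n3 : no m (hh σ '' X3) = ((fun s => Orb m (hh σ (xs σ s))) '' PS σ).ncard := by
    unfold no; rw [hX3, Set.image_image, Set.image_image]
  have iH3 : FInv (hh σ '' X3) := by
    rintro _ ⟨x, hx, rfl⟩ i
    exact ⟨_, iX3 x hx i, hh_pow _ _ _⟩
  have n4 : no m (hh σ '' X1) = no m X1 := by
    unfold no
    rw [Set.image_image]
    apply ncard_same_kernel
    intro x hx y hy
    rw [Orb_eq_iff' hK, Orb_eq_iff' hK]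
    constructor
    · rintro ⟨i, hi⟩
      refine ⟨i, ?_⟩
      rw [hσ, ← hh_pow] at hi
      exact (hy.2 _ hi.symm).symm
    · rintro ⟨i, rfl⟩
      exact ⟨i, hh_pow _ _ _⟩
  have d13 : Disjoint (hh σ '' X3) (hh σ '' X1) := by
    rw [Set.disjoint_left]
    rintro _ ⟨x, hx, rfl⟩ ⟨y, hy, h⟩
    have := hy.2 x h.symm
    subst this
    exact Set.disjoint_left.mp dX hx hy
  have i0 : FInv ({0} : Set K) := by
    rintro x hx i
    rw [Set.mem_singleton_iff] at hx ⊢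
    rw [hx, zero_pow (by positivity)]
  have d0 : Disjoint ({0} : Set K) (hh σ '' X3 ∪ hh σ '' X1) := by
    rw [Set.disjoint_left]
    rintro x hx h
    rw [Set.mem_singleton_iff] at hx
    subst hx
    rcases h with ⟨x, ⟨s, hs, rfl⟩, h⟩ | ⟨x, hx, h⟩
    · exact hh0 s hs h
    · exact hx.1 h
  have iB : FInv {β : K | ∀ x, hh σ x ≠ β} := by
    intro β hβ i x hx
    obtain ⟨z, rfl⟩ : ∃ z, z ^ 2 ^ i = x :=
      (Finite.injective_iff_surjective.mp (iterateFrobenius K 2 i).injective) x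
    rw [hσ, hh_pow] at hx
    exact hβ z ((iterateFrobenius K 2 i).injective hx)
  have hU : (Set.univ : Set K) = {β : K | ∀ x, hh σ x ≠ β} ∪ ({0} ∪ (hh σ '' X3 ∪ hh σ '' X1)) := by
    ext β
    simp only [Set.mem_univ, true_iff]
    by_cases hβ : ∀ x, hh σ x ≠ β
    · exact Or.inl hβ
    · right
      push Not at hβ
      obtain ⟨x, rfl⟩ := hβ
      by_cases h0 : hh σ x = 0
      · left; exact h0
      · right
        rcases hcases x h0 with h | h
        · right; exact ⟨x, h, rfl⟩
        · left; exact ⟨x, h, rfl⟩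
  have dB : Disjoint {β : K | ∀ x, hh σ x ≠ β} ({0} ∪ (hh σ '' X3 ∪ hh σ '' X1)) := by
    rw [Set.disjoint_left]
    intro β hβ h
    rcases h with h | ⟨x, -, h⟩ | ⟨x, -, h⟩
    · rw [Set.mem_singleton_iff] at h
      exact hβ 0 (by rw [h]; simp [hh])
    · exact hβ x h
    · exact hβ x h
  have n5 : no m (Set.univ : Set K) = no m {β : K | ∀ x, hh σ x ≠ β} + (no m {(0:K)} +
      (no m (hh σ '' X3) + no m (hh σ '' X1))) := by
    rw [hU, no_union iB dB, no_union i0 d0, no_union iH3 d13]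
  rw [n5, ← n2, ← n3, n1, n4]
  ring

lemma no_indep [NeZero m] [Finite K] (hK : Nat.card K = 2 ^ m) {k l : ℕ} (hk : Nat.gcd k m = 1)
    (hl : Nat.gcd l m = 1) :
    no m {β : K | ∀ x, hh (Ph (k : ZMod m)) x ≠ β} = no m {β : K | ∀ x, hh (Ph (l : ZMod m)) x ≠ β} := by
  have h1 := no_main hK hk
  have h2 := no_main hK hl
  have a : ∀ k : ℕ, Nat.gcd k m = 1 → ∀ s ∈ {s : K | s ^ 4 ≠ s}, ∀ s' ∈ {s : K | s ^ 4 ≠ s},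
      (Orb m (xs (Ph (k : ZMod m) : K →+* K) s) = Orb m (xs (Ph (k : ZMod m) : K →+* K) s') ↔
        ∃ i : ℕ, (s' = s ^ 2 ^ i ∨ s' = s ^ 2 ^ i + 1)) := by
    intro k hk s hs s' hs'
    rw [← PS_eq hK hk] at hs hs'
    rw [Orb_eq_iff' hK]
    refine exists_congr fun i => ?_
    rw [← xs_pow, eq_comm, xs_eq _ (Ph_fix hK hk) (PS_pow _ hs i) hs']
  have b : ∀ k : ℕ, Nat.gcd k m = 1 → ∀ s ∈ {s : K | s ^ 4 ≠ s}, ∀ s' ∈ {s : K | s ^ 4 ≠ s},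
      (Orb m (hh (Ph (k : ZMod m)) (xs (Ph (k : ZMod m) : K →+* K) s)) =
        Orb m (hh (Ph (k : ZMod m)) (xs (Ph (k : ZMod m) : K →+* K) s')) ↔
        ∃ i : ℕ, An (s ^ 2 ^ i) s') := by
    intro k hk s hs s' hs'
    rw [← PS_eq hK hk] at hs hs'
    rw [Orb_eq_iff' hK]
    refine exists_congr fun i => ?_
    rw [← hh_pow, ← xs_pow, eq_comm, hh_xs_eq _ (Ph_fix hK hk) (PS_pow _ hs i) hs']
  have c1 := ncard_same_kernel {s : K | s ^ 4 ≠ s} (fun s => Orb m (xs (Ph (k : ZMod m) : K →+* K) s))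
    (fun s => Orb m (xs (Ph (l : ZMod m) : K →+* K) s))
    (fun s hs s' hs' => (a k hk s hs s' hs').trans (a l hl s hs s' hs').symm)
  have c2 := ncard_same_kernel {s : K | s ^ 4 ≠ s}
    (fun s => Orb m (hh (Ph (k : ZMod m)) (xs (Ph (k : ZMod m) : K →+* K) s)))
    (fun s => Orb m (hh (Ph (l : ZMod m)) (xs (Ph (l : ZMod m) : K →+* K) s)))
    (fun s hs s' hs' => (b k hk s hs s' hs').trans (b l hl s hs s' hs').symm)
  omega

end Orbits

instance gf_charP (m : ℕ) : CharP (GaloisField 2 m) 2 := inferInstance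

lemma gf_card {m : ℕ} (hm : m ≠ 0) : Nat.card (GaloisField 2 m) = 2 ^ m := GaloisField.card 2 m hm

lemma orbitCount_eq {m : ℕ} (hm : m ≠ 0) (k : ℕ) :
    orbitCount k m = no m {β : GaloisField 2 m | ∀ x, hh (Ph (k : ZMod m)) x ≠ β} := by
  have hK := gf_card hm
  unfold orbitCount no
  congr 1
  ext S
  simp only [Set.mem_setOf_eq, Set.mem_image]
  refine exists_congr fun β => and_congr ?_ ⟨fun h => h.symm, fun h => h.symm⟩
  refine forall_congr' fun x => ?_
  rw [Ne, Ne, not_iff_not, add_eq_zero_two, hh, Ph_natCast hK, pow_succ, mul_comm]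

lemma orbitCount_indep {m : ℕ} (hm : m ≠ 0) {k l : ℕ} (hk : Nat.gcd k m = 1) (hl : Nat.gcd l m = 1) :
    orbitCount k m = orbitCount l m := by
  haveI : NeZero m := ⟨hm⟩
  rw [orbitCount_eq hm, orbitCount_eq hm, no_indep (gf_card hm) hk hl]


section Normal

variable {K : Type*} [Field K] [CharP K 2] {m : ℕ}

/-- root-freeness, i.e. the APN condition -/
def RF (k : ℕ) (α β : K) : Prop := ∀ x : K, x ^ (2 ^ k + 1) + α * x + β ≠ 0

lemma RF.ne_zero {k : ℕ} {α β : K} (h : RF k α β) : β ≠ 0 := by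
  intro hb
  apply h 0
  simp [hb]

lemma rf_scale {k : ℕ} {α β r : K} (hr : r ≠ 0) (h : RF k (α * r ^ 2 ^ k) (β * r * r ^ 2 ^ k)) :
    RF k α β := by
  intro x hx
  apply h (r * x)
  rw [mul_pow, pow_succ r]
  linear_combination (r ^ 2 ^ k * r) * hx

lemma tan_norm [Module (ZMod 2) (K × K)] [NeZero m] [Finite K] (hK : Nat.card K = 2 ^ m) {k : ℕ}
    {α β : K} (hα : α ≠ 0) (h : RF k α β) :
    ∃ β', RF k 1 β' ∧ CCZEquivalent (taniguchi k α β) (taniguchi k 1 β') := by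
  obtain ⟨r, hr⟩ : ∃ r : K, r ^ 2 ^ k = α :=
    (Finite.injective_iff_surjective.mp (iterateFrobenius K 2 k).injective) α
  have hr0 : r ≠ 0 := by
    rintro rfl; rw [zero_pow (by positivity)] at hr; exact hα hr.symm
  have e : taniguchi k α β = taniguchi k (1 * r ^ 2 ^ k) (β / (r * α) * r * r ^ 2 ^ k) := by
    rw [hr, one_mul]; congr 1; field_simp
  have e' : RF k (1 * r ^ 2 ^ k) (β / (r * α) * r * r ^ 2 ^ k) := by
    have : β / (r * α) * r * r ^ 2 ^ k = β := by rw [hr]; field_simp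
    rw [this, one_mul, hr]; exact h
  refine ⟨β / (r * α), rf_scale hr0 e', ?_⟩
  rw [e]
  exact tan_scale hK k 1 _ hr0

lemma tan_flip [Module (ZMod 2) (K × K)] [NeZero m] [Finite K] (hK : Nat.card K = 2 ^ m) {k : ℕ}
    (hk : k ≤ m) {α β : K} (h : RF k α β) :
    ∃ α' β', RF (m - k) α' β' ∧ CCZEquivalent (taniguchi k α β) (taniguchi (m - k) α' β') := by
  have hβ := h.ne_zero
  have e : ((m - k : ℕ) : ZMod m) = -(k : ZMod m) := by
    rw [Nat.cast_sub hk, ZMod.natCast_self, zero_sub]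
  have hc := tan_swap hK (k : ZMod m) α β hβ
  rw [← e, ← tan_eq_TF hK, ← tan_eq_TF hK] at hc
  refine ⟨_, _, ?_, hc⟩
  intro y hy
  obtain ⟨z, rfl⟩ : ∃ z : K, Ph (-(3 * (k : ZMod m))) z = y :=
    (Finite.injective_iff_surjective.mp (RingHom.injective _)) y
  rw [pow_succ, ← Ph_natCast (m := m) hK, e, ← Ph_add hK, add_comm (-(k : ZMod m)), Ph_add hK,
    ← map_mul, ← map_mul, ← map_add, ← map_add, Ph_eq_zero] at hy
  set w : K := Ph (-(k : ZMod m)) z with hw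
  have hzw : z = Ph (k : ZMod m) w := by rw [hw, Ph_neg_cancel hK]
  have hw0 : w ≠ 0 := by
    intro hw0
    rw [hzw, hw0, map_zero] at hy
    simp [hβ] at hy
  have hz0 : Ph (k : ZMod m) w ≠ 0 := by rwa [Ne, Ph_eq_zero]
  rw [hzw] at hy
  apply h w⁻¹
  rw [pow_succ, ← Ph_natCast (m := m) hK, map_inv₀]
  field_simp
  field_simp at hy
  linear_combination hy

lemma rf_zero_odd [NeZero m] [Finite K] (hK : Nat.card K = 2 ^ m) {k : ℕ}
    (hk : Nat.gcd k m = 1) (hm : Odd m) {β : K} (h : RF k 0 β) : False := by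
  have h2k : Nat.gcd (2 * k) m = 1 :=
    Nat.Coprime.mul_left (Nat.coprime_two_left.mpr hm) hk
  let p : K → K := fun x => x ^ (2 ^ k + 1)
  have hp : Function.Injective p := by
    intro x y hxy
    simp only [p] at hxy
    by_cases hy : y = 0
    · subst hy
      rw [zero_pow (by positivity)] at hxy
      exact (pow_eq_zero_iff (by positivity)).mp hxy
    have hz : (x / y) ^ (2 ^ k + 1) = 1 := by
      rw [div_pow, hxy, div_self (pow_ne_zero _ hy)]
    set z := x / y
    have hz0 : z ≠ 0 := by intro h; rw [h, zero_pow (by positivity)] at hz; simp at hz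
    have hz1 : z ^ 2 ^ k = z⁻¹ := by
      rw [pow_succ] at hz; exact eq_inv_of_mul_eq_one_left hz
    have hz2 : Ph ((2 * k : ℕ) : ZMod m) z = z := by
      rw [Ph_natCast hK, two_mul, pow_add, pow_mul, hz1, inv_pow, hz1, inv_inv]
    rcases Ph_fix hK h2k z hz2 with h | h
    · exact absurd h hz0
    · exact (div_eq_one_iff_eq hy).mp h
  obtain ⟨x, hx⟩ := (Finite.injective_iff_surjective.mp hp) β
  apply h x
  simp only [p] at hx
  rw [hx, zero_mul, add_zero, CharTwo.add_self_eq_zero]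

lemma three_dvd {k : ℕ} (hk : Odd k) : 3 ∣ 2 ^ k + 1 := by
  have := hk.nat_add_dvd_pow_add_pow 2 1
  simpa using this

lemma odd_of_even {k : ℕ} (hk : Nat.gcd k m = 1) (hm : Even m) : Odd k := by
  rw [← Nat.not_even_iff_odd]
  intro h
  have := Nat.dvd_gcd h.two_dvd hm.two_dvd
  rw [hk] at this
  omega

lemma cube_pow [NeZero m] [Finite K] (hK : Nat.card K = 2 ^ m) {k : ℕ}
    (hk : Nat.gcd k m = 1) (hm : Even m) (u : Kˣ) : ∃ r : Kˣ, r ^ (2 ^ k + 1) = u ^ 3 := by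
  have hd := three_dvd (odd_of_even hk hm)
  have hker : (powMonoidHom (2 ^ k + 1) : Kˣ →* Kˣ).ker = (powMonoidHom 3 : Kˣ →* Kˣ).ker := by
    ext z
    rw [MonoidHom.mem_ker, MonoidHom.mem_ker, powMonoidHom_apply, powMonoidHom_apply]
    constructor
    · intro h
      have hz : (z : K) ^ (2 ^ k + 1) = 1 := by
        have := congrArg Units.val h; simpa using this
      have hz0 : (z : K) ≠ 0 := z.ne_zero
      have hz1 : (z : K) ^ 2 ^ k = (z : K)⁻¹ := by
        rw [pow_succ] at hz; exact eq_inv_of_mul_eq_one_left hz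
      have hz2 : (z : K) ∉ PS (Ph (k : ZMod m) : K →+* K) := by
        intro h
        apply h
        rw [add_eq_zero_two, Ph_natCast hK, Ph_natCast hK, hz1, inv_pow, hz1, inv_inv]
      rw [PS_eq hK hk] at hz2
      simp only [Set.mem_setOf_eq, not_not] at hz2
      apply Units.ext
      push_cast
      apply mul_right_cancel₀ hz0
      rw [← pow_succ, one_mul]; exact hz2
    · intro h
      obtain ⟨c, hc⟩ := hd
      rw [hc, pow_mul, h, one_pow]
  have hle : (powMonoidHom (2 ^ k + 1) : Kˣ →* Kˣ).range ≤ (powMonoidHom 3 : Kˣ →* Kˣ).range := by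
    rintro _ ⟨z, rfl⟩
    obtain ⟨c, hc⟩ := hd
    refine ⟨z ^ c, ?_⟩
    rw [powMonoidHom_apply, powMonoidHom_apply, hc, ← pow_mul, mul_comm]
  have heq := Subgroup.eq_of_le_of_card_ge hle (by
    rw [← Subgroup.index_ker, ← Subgroup.index_ker, hker])
  have : u ^ 3 ∈ (powMonoidHom (2 ^ k + 1) : Kˣ →* Kˣ).range := by
    rw [heq]; exact ⟨u, rfl⟩
  obtain ⟨r, hr⟩ := this
  exact ⟨r, hr⟩

lemma tan_zero_even [Module (ZMod 2) (K × K)] [NeZero m] [Finite K] (hK : Nat.card K = 2 ^ m) {k : ℕ}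
    (hk : Nat.gcd k m = 1) (hm : Even m) {β β' : K} (h : RF k 0 β) (h' : RF k 0 β') :
    CCZEquivalent (taniguchi k 0 β) (taniguchi k 0 β') := by
  obtain ⟨g, hg⟩ := IsCyclic.exists_generator (α := Kˣ)
  have key : ∀ γ : K, RF k 0 γ → ∃ a : ℤ, γ = ((g ^ a : Kˣ) : K) ∧ a % 3 ≠ 0 := by
    intro γ hγ
    obtain ⟨a, ha⟩ := hg (Units.mk0 γ hγ.ne_zero)
    have ha' : γ = ((g ^ a : Kˣ) : K) := by
      have := congrArg Units.val ha; simpa using this.symm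
    refine ⟨a, ha', fun h3 => ?_⟩
    obtain ⟨r, hr⟩ := cube_pow hK hk hm (g ^ (a / 3))
    have : g ^ a = r ^ (2 ^ k + 1) := by
      rw [hr, ← zpow_natCast, ← zpow_mul]; congr 1; push_cast; omega
    apply hγ r
    rw [ha', this]
    push_cast
    rw [zero_mul, add_zero, CharTwo.add_self_eq_zero]
  obtain ⟨a, ha, ha3⟩ := key β h
  obtain ⟨b, hb, hb3⟩ := key β' h'
  have sc : ∀ (γ : K) (r : Kˣ), CCZEquivalent (taniguchi k 0 γ) (taniguchi k 0 (γ * ((r ^ (2 ^ k + 1) : Kˣ) : K))) := by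
    intro γ r
    have := tan_scale hK k 0 γ r.ne_zero
    rw [zero_mul] at this
    have e : γ * ((r ^ (2 ^ k + 1) : Kˣ) : K) = γ * r * r ^ 2 ^ k := by push_cast; ring
    rw [e]
    exact ccz_symm this
  have hcase : b % 3 = a % 3 ∨ b % 3 = (2 * a) % 3 := by omega
  rcases hcase with hc | hc
  · obtain ⟨r, hr⟩ := cube_pow hK hk hm (g ^ ((b - a) / 3))
    have e : β' = β * ((r ^ (2 ^ k + 1) : Kˣ) : K) := by
      rw [hr, ha, hb, ← Units.val_mul, ← zpow_natCast, ← zpow_mul, ← zpow_add]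
      congr 2; push_cast; omega
    rw [e]; exact sc β r
  · obtain ⟨r, hr⟩ := cube_pow hK hk hm (g ^ ((b - 2 * a) / 3))
    have e : β' = β ^ 2 * ((r ^ (2 ^ k + 1) : Kˣ) : K) := by
      rw [hr, ha, hb, ← Units.val_pow_eq_pow_val, ← Units.val_mul, ← zpow_natCast, ← zpow_mul,
        ← zpow_natCast, ← zpow_mul, ← zpow_add]
      congr 2; push_cast; omega
    have h1 := tan_frob hK k 0 β 1
    simp only [pow_one] at h1
    rw [zero_pow (by norm_num)] at h1
    rw [e]; exact ccz_trans h1 (sc _ r)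

lemma exists_zero_even [NeZero m] [Finite K] (hK : Nat.card K = 2 ^ m) {k : ℕ}
    (hk : Nat.gcd k m = 1) (hm : Even m) : ∃ β : K, RF k 0 β := by
  have hdv : 3 ∣ Nat.card Kˣ := by
    rw [Nat.card_units, hK]
    obtain ⟨n, rfl⟩ := hm
    have : (4 - 1) ∣ 4 ^ n - 1 := by simpa using Nat.sub_dvd_pow_sub_pow 4 1 n
    have e : 2 ^ (n + n) = 4 ^ n := by rw [← two_mul, pow_mul]; norm_num
    rw [e]; exact this
  haveI : Fact (Nat.Prime 3) := ⟨Nat.prime_three⟩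
  obtain ⟨w, hw⟩ := exists_prime_orderOf_dvd_card' (G := Kˣ) 3 hdv
  have hns : ¬ Function.Surjective (fun u : Kˣ => u ^ 3) := by
    intro hs
    have hi := Finite.injective_iff_surjective.mpr hs
    have h1 : w = 1 := by
      apply hi
      simp only [one_pow]
      rw [← hw, pow_orderOf_eq_one]
    rw [h1, orderOf_one] at hw
    omega
  unfold Function.Surjective at hns
  push Not at hns
  obtain ⟨b, hb⟩ := hns
  refine ⟨b, fun x hx => ?_⟩
  rw [zero_mul, add_zero, add_eq_zero_two] at hx
  have hx0 : x ≠ 0 := by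
    rintro rfl; rw [zero_pow (by positivity)] at hx; exact b.ne_zero hx.symm
  obtain ⟨c, hc⟩ := three_dvd (odd_of_even hk hm)
  apply hb (Units.mk0 x hx0 ^ c)
  apply Units.ext
  push_cast
  rw [← hx, hc, ← pow_mul, mul_comm, Units.val_mk0]

lemma card_eight [Finite K] (hK : Nat.card K = 2 ^ 3) {β β' : K} (h : RF 1 1 β) (h' : RF 1 1 β') :
    Orb 3 β = Orb 3 β' := by
  have h2 : (2 : K) = 0 := CharTwo.two_eq_zero
  haveI : NeZero 3 := ⟨by norm_num⟩
  have key : ∀ γ : K, RF 1 1 γ → γ = 1 ∨ γ ^ 3 + γ + 1 = 0 := by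
    intro γ hγ
    have h8 : γ ^ 8 = γ := pow_card2 hK γ
    have hf : γ * ((γ + 1) * ((γ ^ 3 + γ + 1) * (γ ^ 3 + γ ^ 2 + 1))) = 0 := by
      grind
    rcases mul_eq_zero.mp ((mul_eq_zero.mp hf).resolve_left hγ.ne_zero) with h | h
    · left; exact add_eq_zero_two.mp h
    · rcases mul_eq_zero.mp h with h | h
      · exact Or.inr h
      · exfalso
        apply hγ (γ ^ 2)
        norm_num
        grind
  have bad : ∀ γ : K, γ ^ 3 + γ + 1 = 0 → RF 1 1 (1 : K) → False := by
    intro γ hγ h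
    apply h γ
    norm_num
    exact hγ
  have conj : ∀ γ δ : K, γ ^ 3 + γ + 1 = 0 → δ ^ 3 + δ + 1 = 0 → Orb 3 γ = Orb 3 δ := by
    intro γ δ hγ hδ
    rw [Orb_eq_iff' hK]
    have hf : (δ + γ) * ((δ + γ ^ 2) * (δ + γ ^ 4)) = 0 := by grind
    rcases mul_eq_zero.mp hf with h | h
    · exact ⟨0, by simpa using add_eq_zero_two.mp h⟩
    · rcases mul_eq_zero.mp h with h | h
      · exact ⟨1, by simpa using add_eq_zero_two.mp h⟩
      · exact ⟨2, by simpa using add_eq_zero_two.mp h⟩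
  rcases key β h with h1 | h1 <;> rcases key β' h' with h3 | h3
  · rw [h1, h3]
  · exact (bad _ h3 (h1 ▸ h)).elim
  · exact (bad _ h1 (h3 ▸ h')).elim
  · exact conj _ _ h1 h3

end Normal


section Final

/-- the equivalence class inside `TanSet` -/
def cls (m : ℕ) (f : GaloisField 2 m × GaloisField 2 m → GaloisField 2 m × GaloisField 2 m) :
    Set ((GaloisField 2 m × GaloisField 2 m) → (GaloisField 2 m × GaloisField 2 m)) :=
  {g | g ∈ TanSet m ∧ CCZEquivalent f g}

lemma num_eq (m : ℕ) : numTaniguchiClasses m = (cls m '' TanSet m).ncard := by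
  unfold numTaniguchiClasses
  congr 1
  ext C
  constructor
  · rintro ⟨f, hf, rfl⟩; exact ⟨f, hf, rfl⟩
  · rintro ⟨f, hf, rfl⟩; exact ⟨f, hf, rfl⟩

lemma cls_eq {m : ℕ} {f g : GaloisField 2 m × GaloisField 2 m → GaloisField 2 m × GaloisField 2 m}
    (hg : g ∈ TanSet m) : cls m f = cls m g ↔ CCZEquivalent f g := by
  constructor
  · intro h
    have : g ∈ cls m f := by rw [h]; exact ⟨hg, ccz_refl g⟩
    exact this.2
  · intro h
    ext e
    exact ⟨fun he => ⟨he.1, ccz_trans (ccz_symm h) he.2⟩, fun he => ⟨he.1, ccz_trans h he.2⟩⟩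

/-- half of the exponents -/
def Dk (m : ℕ) : Finset ℕ := (Finset.range m).filter (fun k => 0 < k ∧ 2 * k < m ∧ Nat.gcd k m = 1)

lemma mem_Dk {m k : ℕ} : k ∈ Dk m ↔ 0 < k ∧ 2 * k < m ∧ Nat.gcd k m = 1 := by
  simp only [Dk, Finset.mem_filter, Finset.mem_range]
  constructor
  · rintro ⟨_, h⟩; exact h
  · intro h; exact ⟨by omega, h⟩

lemma gcd_sub' {m k : ℕ} (hk : k ≤ m) (h : Nat.gcd k m = 1) : Nat.gcd (m - k) m = 1 := by
  have := (Nat.coprime_self_sub_left hk).2 (show Nat.Coprime k m from h)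
  exact this

lemma two_card_Dk {m : ℕ} (hm : 3 ≤ m) : 2 * (Dk m).card = Nat.totient m := by
  have h1 : Nat.totient m = ((Finset.range m).filter (fun k => Nat.Coprime m k)).card := rfl
  have h2 : (Finset.range m).filter (fun k => Nat.Coprime m k) =
      Dk m ∪ (Dk m).image (fun k => m - k) := by
    ext k
    simp only [Finset.mem_filter, Finset.mem_range, Finset.mem_union, Finset.mem_image, mem_Dk]
    constructor
    · rintro ⟨hk, hc⟩
      have hc' : Nat.gcd k m = 1 := hc.symm
      have hk0 : 0 < k := by
        rcases Nat.eq_zero_or_pos k with rfl | h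
        · rw [Nat.gcd_zero_left] at hc'; omega
        · exact h
      have hne : 2 * k ≠ m := by
        intro h
        have : k ∣ Nat.gcd k m := Nat.dvd_gcd dvd_rfl ⟨2, by omega⟩
        rw [hc'] at this
        have := Nat.dvd_one.mp this
        omega
      rcases lt_or_gt_of_ne hne with h | h
      · exact Or.inl ⟨hk0, h, hc'⟩
      · exact Or.inr ⟨m - k, ⟨by omega, by omega, gcd_sub' hk.le hc'⟩, by omega⟩
    · rintro (⟨h0, h, hc⟩ | ⟨j, ⟨h0, h, hc⟩, rfl⟩)
      · exact ⟨by omega, Nat.Coprime.symm hc⟩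
      · exact ⟨by omega, Nat.Coprime.symm (gcd_sub' (by omega) hc)⟩
  rw [h1, h2, Finset.card_union_of_disjoint, Finset.card_image_of_injOn]
  · ring
  · intro a ha b hb hab
    have ha' := mem_Dk.mp (Finset.mem_coe.mp ha)
    have hb' := mem_Dk.mp (Finset.mem_coe.mp hb)
    simp only at hab
    omega
  · rw [Finset.disjoint_left]
    intro a ha hb
    obtain ⟨b, hbD, rfl⟩ := Finset.mem_image.mp hb
    have ha' := mem_Dk.mp ha
    have hb' := mem_Dk.mp hbD
    omega

lemma ncard_biUnion_const {X : Type*} (D : Finset ℕ) (R : ℕ → Set X) (c : ℕ)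
    (hfin : ∀ k ∈ D, (R k).Finite) (hc : ∀ k ∈ D, (R k).ncard = c)
    (hd : ∀ k ∈ D, ∀ l ∈ D, k ≠ l → Disjoint (R k) (R l)) :
    (⋃ k ∈ D, R k).ncard = D.card * c := by
  induction D using Finset.induction_on with
  | empty => simp
  | insert a s ha ih =>
    have f1 := hfin a (Finset.mem_insert_self _ _)
    have f2 : (⋃ k ∈ s, R k).Finite :=
      Set.Finite.biUnion s.finite_toSet (fun k hk => hfin k (Finset.mem_insert_of_mem hk))
    rw [Finset.set_biUnion_insert, Set.ncard_union_eq ?_ f1 f2, Finset.card_insert_of_notMem ha,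
      hc a (Finset.mem_insert_self _ _), ih]
    · ring
    · exact fun k hk => hfin k (Finset.mem_insert_of_mem hk)
    · exact fun k hk => hc k (Finset.mem_insert_of_mem hk)
    · exact fun k hk l hl => hd k (Finset.mem_insert_of_mem hk) l (Finset.mem_insert_of_mem hl)
    · rw [Set.disjoint_iUnion₂_right]
      intro l hl
      exact hd a (Finset.mem_insert_self _ _) l (Finset.mem_insert_of_mem hl)
        (by rintro rfl; exact ha hl)

lemma tan_mem {m k : ℕ} (hk : k ∈ Dk m) {α β : GaloisField 2 m} (h : RF k α β) :
    taniguchi k α β ∈ TanSet m := by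
  have := mem_Dk.mp hk
  exact ⟨k, α, β, this.1, by omega, this.2.2, h.ne_zero, h, rfl⟩

lemma mod_eq_Dk {m k l : ℕ} (hk : k ∈ Dk m) (hl : l ∈ Dk m)
    (h : (k : ZMod m) = l ∨ (k : ZMod m) = -l) : k = l := by
  have hk' := mem_Dk.mp hk
  have hl' := mem_Dk.mp hl
  rcases h with h | h
  · rw [ZMod.natCast_eq_natCast_iff'] at h
    rwa [Nat.mod_eq_of_lt (by omega), Nat.mod_eq_of_lt (by omega)] at h
  · exfalso
    have : ((k + l : ℕ) : ZMod m) = 0 := by rw [Nat.cast_add, h, neg_add_cancel]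
    rw [ZMod.natCast_eq_zero_iff] at this
    have := Nat.le_of_dvd (by omega) this
    omega

lemma key_k {m : ℕ} (hm : 3 ≤ m) {k l : ℕ} (hk : k ∈ Dk m) (hl : l ∈ Dk m)
    {α β α' β' : GaloisField 2 m} (h : RF k α β) (h' : RF l α' β')
    (hc : CCZEquivalent (taniguchi k α β) (taniguchi l α' β')) : k = l := by
  have hk' := mem_Dk.mp hk
  have hl' := mem_Dk.mp hl
  rcases Nat.lt_or_ge m 4 with h4 | h4
  · omega
  · exact mod_eq_Dk hk hl (tan_inequiv h4 (gf_card (by omega)) hk'.2.2 hl'.2.2 h.ne_zero h'.ne_zero h h' hc).1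

lemma key_one {m : ℕ} (hm : 3 ≤ m) {k : ℕ} (hk : k ∈ Dk m)
    {β β' : GaloisField 2 m} (h : RF k 1 β) (h' : RF k 1 β') :
    CCZEquivalent (taniguchi k 1 β) (taniguchi k 1 β') ↔ Orb m β = Orb m β' := by
  have hk' := mem_Dk.mp hk
  haveI : NeZero m := ⟨by omega⟩
  have hK : Nat.card (GaloisField 2 m) = 2 ^ m := gf_card (by omega)
  constructor
  · intro hc
    rcases Nat.lt_or_ge m 4 with h4 | h4
    · have hm3 : m = 3 := by omega
      subst hm3
      have hk1 : k = 1 := by omega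
      subst hk1
      exact card_eight hK h h'
    · rcases (tan_inequiv h4 hK hk'.2.2 hk'.2.2 h.ne_zero h'.ne_zero h h' hc).2 rfl with h0 | h0
      · exact absurd h0.1 one_ne_zero
      · obtain ⟨ρ, r, hρ, hr, ha, hb⟩ := h0
        rw [one_pow, one_mul] at ha
        have hr1 : r = 1 := by
          have e : (iterateFrobenius (GaloisField 2 m) 2 k) r = (iterateFrobenius (GaloisField 2 m) 2 k) 1 := by
            rw [map_one]; exact ha.symm
          exact (iterateFrobenius (GaloisField 2 m) 2 k).injective e
        rw [hr1, one_pow, mul_one, mul_one] at hb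
        exact (Orb_eq_iff' hK _ _).2 ⟨ρ, hb.symm⟩
  · intro ho
    obtain ⟨i, rfl⟩ := (Orb_eq_iff' hK _ _).1 ho
    have := tan_frob hK k 1 β i
    rwa [one_pow] at this

lemma key_zero {m : ℕ} (hm : 4 ≤ m) {k : ℕ} (hk : k ∈ Dk m)
    {β β' : GaloisField 2 m} (h : RF k 1 β) (h' : RF k 0 β') 
    (hc : CCZEquivalent (taniguchi k 1 β) (taniguchi k 0 β')) : False := by
  have hk' := mem_Dk.mp hk
  have hK : Nat.card (GaloisField 2 m) = 2 ^ m := gf_card (by omega)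
  rcases (tan_inequiv hm hK hk'.2.2 hk'.2.2 h.ne_zero h'.ne_zero h h' hc).2 rfl with h0 | h0
  · exact one_ne_zero h0.1
  · obtain ⟨ρ, r, -, -, ha, -⟩ := h0
    rw [one_pow, zero_mul] at ha
    exact one_ne_zero ha

/-- classes with `α = 1` -/
def R1 (m k : ℕ) := (fun β : GaloisField 2 m => cls m (taniguchi k 1 β)) '' {β | RF k 1 β}
/-- classes with `α = 0` -/
def R0 (m k : ℕ) := (fun β : GaloisField 2 m => cls m (taniguchi k 0 β)) '' {β | RF k 0 β}

lemma R1_card {m k : ℕ} (hm : 3 ≤ m) (hk : k ∈ Dk m) : (R1 m k).ncard = orbitCount k m := by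
  have h1 : orbitCount k m = (Orb m '' {β : GaloisField 2 m | RF k 1 β}).ncard := by
    unfold orbitCount
    congr 1
    ext S
    simp only [Set.mem_setOf_eq, Set.mem_image, RF, one_mul]
    refine exists_congr fun β => and_congr Iff.rfl ⟨fun h => h.symm, fun h => h.symm⟩
  rw [h1]
  apply ncard_same_kernel
  intro β hβ β' hβ'
  rw [cls_eq (tan_mem hk hβ')]
  exact key_one hm hk hβ hβ'

lemma classes_eq {m : ℕ} (hm : 3 ≤ m) : cls m '' TanSet m = ⋃ k ∈ Dk m, (R1 m k ∪ R0 m k) := by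
  haveI : NeZero m := ⟨by omega⟩
  have hK : Nat.card (GaloisField 2 m) = 2 ^ m := gf_card (by omega)
  have step : ∀ k ∈ Dk m, ∀ (α β : GaloisField 2 m) f, RF k α β → CCZEquivalent f (taniguchi k α β) →
      cls m f ∈ R1 m k ∪ R0 m k := by
    intro k hk α β f h hc
    by_cases hα : α = 0
    · subst hα
      right
      exact ⟨β, h, ((cls_eq (tan_mem hk h)).2 hc).symm⟩
    · obtain ⟨β', h', hc'⟩ := tan_norm hK hα h
      left
      exact ⟨β', h', ((cls_eq (tan_mem hk h')).2 (ccz_trans hc hc')).symm⟩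
  ext C
  simp only [Set.mem_iUnion]
  constructor
  · rintro ⟨f, ⟨k, α, β, hk0, hkm, hg, hβ, h, rfl⟩, rfl⟩
    have hne : 2 * k ≠ m := by
      intro h
      have : k ∣ Nat.gcd k m := Nat.dvd_gcd dvd_rfl ⟨2, by omega⟩
      rw [hg] at this
      have := Nat.dvd_one.mp this
      omega
    rcases lt_or_gt_of_ne hne with hlt | hgt
    · have hk : k ∈ Dk m := mem_Dk.mpr ⟨hk0, hlt, hg⟩
      exact ⟨k, hk, step k hk α β _ h (ccz_refl _)⟩
    · have hk : m - k ∈ Dk m := mem_Dk.mpr ⟨by omega, by omega, gcd_sub' hkm.le hg⟩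
      obtain ⟨α', β', h', hc⟩ := tan_flip hK hkm.le h
      exact ⟨m - k, hk, step _ hk α' β' _ h' hc⟩
  · rintro ⟨k, hk, ⟨β, h, rfl⟩ | ⟨β, h, rfl⟩⟩
    · exact ⟨_, tan_mem hk h, rfl⟩
    · exact ⟨_, tan_mem hk h, rfl⟩

lemma R_disj {m : ℕ} (hm : 3 ≤ m) {k l : ℕ} (hk : k ∈ Dk m) (hl : l ∈ Dk m) (hkl : k ≠ l) :
    Disjoint (R1 m k ∪ R0 m k) (R1 m l ∪ R0 m l) := by
  have ex : ∀ k C, C ∈ R1 m k ∪ R0 m k → ∃ α β, RF k α β ∧ C = cls m (taniguchi k α β) := by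
    rintro k C (⟨β, h, rfl⟩ | ⟨β, h, rfl⟩)
    · exact ⟨1, β, h, rfl⟩
    · exact ⟨0, β, h, rfl⟩
  rw [Set.disjoint_left]
  intro C h1 h2
  obtain ⟨α, β, h, rfl⟩ := ex k C h1
  obtain ⟨α', β', h', e⟩ := ex l _ h2
  exact hkl (key_k hm hk hl h h' ((cls_eq (tan_mem hl h')).1 e))

lemma R_fin {m k : ℕ} : (R1 m k ∪ R0 m k).Finite :=
  ((Set.toFinite _).image _).union ((Set.toFinite _).image _)

lemma final_count {m k c : ℕ} (hm : 3 ≤ m)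
    (hR : ∀ k ∈ Dk m, (R1 m k ∪ R0 m k).ncard = c) :
    2 * numTaniguchiClasses m = Nat.totient m * c := by
  rw [num_eq, classes_eq hm, ncard_biUnion_const (Dk m) _ c (fun _ _ => R_fin) hR
    (fun k hk l hl hkl => R_disj hm hk hl hkl), ← two_card_Dk hm, mul_assoc]

end Final

/-- For `m ≥ 3`, the number of CCZ-inequivalent APN Taniguchi functions on
`F_{2^m} × F_{2^m}` equals `φ(m)·b(m)/2` if `m` is odd and `φ(m)·(b(m)+1)/2` if `m` is
even (stated multiplicatively). -/
theorem number_of_taniguchi_classes (m k : ℕ) (hm : 3 ≤ m) (hk : 0 < k) (hkm : k < m)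
    (hgcd : Nat.gcd k m = 1) :
    (Odd m → 2 * numTaniguchiClasses m = Nat.totient m * orbitCount k m) ∧
    (Even m → 2 * numTaniguchiClasses m = Nat.totient m * (orbitCount k m + 1)) := by
  haveI : NeZero m := ⟨by omega⟩
  have hK : Nat.card (GaloisField 2 m) = 2 ^ m := gf_card (by omega)
  constructor
  · intro hodd
    apply final_count (k := k) hm
    intro l hl
    have hl' := mem_Dk.mp hl
    have h0 : R0 m l = ∅ := by
      unfold R0
      rw [Set.image_eq_empty, Set.eq_empty_iff_forall_notMem]
      intro β hβ
      exact rf_zero_odd hK hl'.2.2 hodd hβ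
    rw [h0, Set.union_empty, R1_card hm hl]
    exact orbitCount_indep (by omega) hl'.2.2 hgcd
  · intro heven
    apply final_count (k := k) hm
    intro l hl
    have hl' := mem_Dk.mp hl
    have hm4 : 4 ≤ m := by
      obtain ⟨n, rfl⟩ := heven
      omega
    obtain ⟨β0, hβ0⟩ := exists_zero_even hK hl'.2.2 heven
    have h0 : R0 m l = {cls m (taniguchi l 0 β0)} := by
      ext C
      rw [Set.mem_singleton_iff]
      constructor
      · rintro ⟨β, hβ, rfl⟩
        exact (cls_eq (tan_mem hl hβ0)).2 (tan_zero_even hK hl'.2.2 heven hβ hβ0)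
      · rintro rfl
        exact ⟨β0, hβ0, rfl⟩
    have hd : Disjoint (R1 m l) (R0 m l) := by
      rw [Set.disjoint_left]
      rintro _ ⟨β, hβ, rfl⟩ ⟨β', hβ', e⟩
      exact key_zero hm4 hl hβ hβ' ((cls_eq (tan_mem hl hβ')).1 e.symm)
    rw [Set.ncard_union_eq hd ((Set.toFinite _).image _) ((Set.toFinite _).image _), h0,
      Set.ncard_singleton, R1_card hm hl, orbitCount_indep (by omega) hl'.2.2 hgcd]
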